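/- For every integer n ≥ 1 there exists a constant γ ≥ 1 such that the Heisenberg group ℍⁿ, equipped with the Carnot–Carathéodory metric, is Lipschitz (n−1)-connected with constant γ; that is, for every k ∈ {0,1,…,n−1} and every L ≥ 0, every L-Lipschitz map f : S^k → ℍⁿ has a γL-Lipschitz extension F : B^{k+1} → ℍⁿ. -/

import Mathlib

open MeasureTheory Metric Set
noncomputable section

/-- `Euc d` is `ℝ^d` with the Euclidean metric. -/
abbrev Euc (d : ℕ) := EuclideanSpace ℝ (Fin d)

/-- The index of the coordinate `x_j` in `ℍⁿ = ℝ^{2n+1}`. -/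
def xIdx (n : ℕ) (j : Fin n) : Fin (2*n+1) := ⟨2*(j:ℕ), by have := j.isLt; omega⟩

/-- The index of the coordinate `y_j` in `ℍⁿ = ℝ^{2n+1}`. -/
def yIdx (n : ℕ) (j : Fin n) : Fin (2*n+1) := ⟨2*(j:ℕ)+1, by have := j.isLt; omega⟩

/-- The index of the coordinate `t` in `ℍⁿ = ℝ^{2n+1}`. -/
def tIdx (n : ℕ) : Fin (2*n+1) := ⟨2*n, by omega⟩

/-- `γ` is an absolutely continuous curve on `[a,b]` with a.e. derivative `g`
(each component is the integral of the corresponding component of `g`), which is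
horizontal: the derivative of the `t`-component satisfies the contact condition. -/
def IsHorizontalWith (n : ℕ) (a b : ℝ) (γ g : ℝ → Euc (2*n+1)) : Prop :=
  (∀ i, IntervalIntegrable (fun s => g s i) volume a b) ∧
  (∀ i, ∀ x ∈ Set.Icc a b, γ x i = γ a i + ∫ s in a..x, g s i) ∧
  (∀ᵐ s ∂(volume.restrict (Set.Icc a b)),
    g s (tIdx n) = 2 * ∑ j : Fin n,
      (γ s (yIdx n j) * g s (xIdx n j) - γ s (xIdx n j) * g s (yIdx n j)))

/-- The horizontal length of a horizontal curve with a.e. derivative `g`: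
the Euclidean length of the projection to `ℝ^{2n}`. -/
def horizLength (n : ℕ) (a b : ℝ) (g : ℝ → Euc (2*n+1)) : ℝ :=
  ∫ s in a..b, Real.sqrt (∑ j : Fin n, ((g s (xIdx n j))^2 + (g s (yIdx n j))^2))

/-- The Carnot–Carathéodory distance on `ℍⁿ`. -/
def ccDist (n : ℕ) (p q : Euc (2*n+1)) : ℝ :=
  sInf { ℓ : ℝ | ∃ a b γ g, a ≤ b ∧ IsHorizontalWith n a b γ g ∧
    γ a = p ∧ γ b = q ∧ ℓ = horizLength n a b g }

/-- `f` is `L`-Lipschitz on `Z` as a map into `ℍⁿ` with the Carnot–Carathéodory metric. -/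
def LipschitzOnCC (m n : ℕ) (L : ℝ) (Z : Set (Euc m)) (f : Euc m → Euc (2*n+1)) : Prop :=
  ∀ x ∈ Z, ∀ y ∈ Z, ccDist n (f x) (f y) ≤ L * dist x y

/-- `v` represents the distributional partial derivative `∂u/∂x_k` on `Ω`. -/
def IsWeakPartialDeriv (m : ℕ) (Ω : Set (Euc m)) (u : Euc m → ℝ) (k : Fin m)
    (v : Euc m → ℝ) : Prop :=
  ∀ φ : Euc m → ℝ, ContDiff ℝ (⊤ : ℕ∞) φ → HasCompactSupport φ → tsupport φ ⊆ Ω →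
    ∫ x in Ω, u x * fderiv ℝ φ x (EuclideanSpace.single k 1) = - ∫ x in Ω, v x * φ x

/-- `u ∈ L^p(Ω)`. -/
def MemLpOn (m : ℕ) (p : ℝ) (Ω : Set (Euc m)) (u : Euc m → ℝ) : Prop :=
  MemLp u (ENNReal.ofReal p) (volume.restrict Ω)

/-- `u ∈ W^{1,p}(Ω)` with weak partial derivatives `v k = ∂u/∂x_k ∈ L^p(Ω)`. -/
def MemW1pWith (m : ℕ) (p : ℝ) (Ω : Set (Euc m)) (u : Euc m → ℝ)
    (v : Fin m → Euc m → ℝ) : Prop :=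
  MemLpOn m p Ω u ∧ ∀ k, MemLpOn m p Ω (v k) ∧ IsWeakPartialDeriv m Ω u k (v k)

/-- The weak contact equation holds a.e. on `Ω` for `F` with weak partial
derivatives `v i k = ∂F_i/∂x_k`. -/
def ContactAEOn (m n : ℕ) (Ω : Set (Euc m)) (F : Euc m → Euc (2*n+1))
    (v : Fin (2*n+1) → Fin m → Euc m → ℝ) : Prop :=
  ∀ᵐ x ∂(volume.restrict Ω), ∀ k : Fin m,
    v (tIdx n) k x = 2 * ∑ j : Fin n,
      (F x (yIdx n j) * v (xIdx n j) k x - F x (xIdx n j) * v (yIdx n j) k x)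

/-- `F ∈ W^{1,p}(Ω,ℍⁿ)` with weak partial derivatives `v`:
all components belong to `W^{1,p}(Ω)` and the weak contact equation holds a.e. -/
def MemW1pHeisWith (m n : ℕ) (p : ℝ) (Ω : Set (Euc m)) (F : Euc m → Euc (2*n+1))
    (v : Fin (2*n+1) → Fin m → Euc m → ℝ) : Prop :=
  (∀ i, MemW1pWith m p Ω (fun x => F x i) (fun k => v i k)) ∧ ContactAEOn m n Ω F v

namespace HeisenbergExtension

open Filter Topology
open scoped ContDiff

/-! ### One-dimensional building blocks -/

/-- A smooth step rising from `0` to `1` on `[3/10, 7/20]`. -/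
def stepFn (t : ℝ) : ℝ := Real.smoothTransition (20 * t - 6)

/-- A smooth bump whose integer translates form a partition of unity of `ℝ`. -/
def bump (t : ℝ) : ℝ := stepFn (t + 1) - stepFn t

/-- A smooth staircase at bounded distance from the identity, rising only on
`ℤ + [0, 1/10]`. -/
def stair (t : ℝ) : ℝ := ⌊t⌋ + Real.smoothTransition (10 * Int.fract t)

lemma contDiff_stepFn : ContDiff ℝ ∞ stepFn :=
  (Real.smoothTransition.contDiff (n := ⊤)).comp
    ((contDiff_const.mul contDiff_id).sub contDiff_const)

lemma contDiff_bump : ContDiff ℝ ∞ bump :=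
  (contDiff_stepFn.comp (contDiff_id.add contDiff_const)).sub contDiff_stepFn

lemma stepFn_eq_zero {t : ℝ} (h : t ≤ 3 / 10) : stepFn t = 0 :=
  Real.smoothTransition.zero_of_nonpos (by linarith)

lemma stepFn_eq_one {t : ℝ} (h : 7 / 20 ≤ t) : stepFn t = 1 :=
  Real.smoothTransition.one_of_one_le (by linarith)

lemma mem_of_bump_ne_zero {t : ℝ} (h : bump t ≠ 0) : -7 / 10 < t ∧ t < 7 / 20 := by
  by_contra hc
  rw [not_and_or, not_lt, not_lt] at hc
  apply h
  rcases hc with hc | hc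
  · simp [bump, stepFn_eq_zero (t := t) (by linarith), stepFn_eq_zero (t := t + 1) (by linarith)]
  · simp [bump, stepFn_eq_one hc, stepFn_eq_one (t := t + 1) (by linarith)]

lemma mem_of_deriv_stepFn_ne_zero {t : ℝ} (h : deriv stepFn t ≠ 0) :
    3 / 10 ≤ t ∧ t ≤ 7 / 20 := by
  by_contra hc
  rw [not_and_or, not_le, not_le] at hc
  apply h
  rcases hc with hc | hc
  · have : stepFn =ᶠ[𝓝 t] fun _ => 0 := by
      filter_upwards [Iio_mem_nhds hc] with s hs using stepFn_eq_zero (le_of_lt hs)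
    rw [this.deriv_eq]; simp
  · have : stepFn =ᶠ[𝓝 t] fun _ => 1 := by
      filter_upwards [Ioi_mem_nhds hc] with s hs using stepFn_eq_one (le_of_lt hs)
    rw [this.deriv_eq]; simp

lemma mem_of_deriv_bump_ne_zero {t : ℝ} (h : deriv bump t ≠ 0) :
    (3 / 10 ≤ t ∧ t ≤ 7 / 20) ∨ (3 / 10 ≤ t + 1 ∧ t + 1 ≤ 7 / 20) := by
  have hd : Differentiable ℝ stepFn := contDiff_stepFn.differentiable (by simp)
  have : deriv bump t = deriv stepFn (t + 1) - deriv stepFn t := by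
    have h1 : HasDerivAt (fun s => stepFn (s + 1)) (deriv stepFn (t + 1)) t :=
      (hd (t + 1)).hasDerivAt.comp_add_const t 1
    exact (h1.sub (hd t).hasDerivAt).deriv
  by_cases h0 : deriv stepFn t = 0
  · right
    apply mem_of_deriv_stepFn_ne_zero
    intro h1; apply h; rw [this, h0, h1, sub_zero]
  · exact Or.inl (mem_of_deriv_stepFn_ne_zero h0)

lemma sum_bump_window {t : ℝ} (h1 : -1 ≤ t) (h2 : t ≤ 3) :
    ∑ k : Fin 5, bump (t - (((k : ℕ) : ℤ) - 1 : ℤ)) = 1 := by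
  simp only [Fin.sum_univ_succ, bump]
  simp
  have e1 := stepFn_eq_one (t := t + 1 + 1) (by linarith)
  have e2 := stepFn_eq_zero (t := t - (4 - 1)) (by linarith)
  norm_num at *
  grind

lemma stair_eventuallyEq (k : ℤ) {t : ℝ} (h1 : (k : ℝ) - 9 / 10 < t) (h2 : t < k + 1) :
    stair =ᶠ[𝓝 t] fun s => k + Real.smoothTransition (10 * (s - k)) := by
  filter_upwards [Ioo_mem_nhds h1 h2] with s hs
  rcases le_or_gt (k : ℝ) s with h | h
  · have hf : ⌊s⌋ = k := Int.floor_eq_iff.2 ⟨h, hs.2⟩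
    simp [stair, Int.fract, hf]
  · have hf : ⌊s⌋ = k - 1 :=
      Int.floor_eq_iff.2 ⟨by push_cast; linarith [hs.1], by push_cast; linarith⟩
    have e1 : Real.smoothTransition (10 * (s - k)) = 0 :=
      Real.smoothTransition.zero_of_nonpos (by linarith)
    have e2 : Real.smoothTransition (10 * (s - (k - 1))) = 1 :=
      Real.smoothTransition.one_of_one_le (by linarith [hs.1])
    simp [stair, Int.fract, hf, e1, e2]

lemma contDiff_stair : ContDiff ℝ ∞ stair := by
  rw [contDiff_iff_contDiffAt]
  intro t
  have h := stair_eventuallyEq ⌊t⌋ (t := t) (by linarith [Int.floor_le t]) (Int.lt_floor_add_one t)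
  refine ContDiffAt.congr_of_eventuallyEq ?_ h
  apply ContDiff.contDiffAt
  exact contDiff_const.add ((Real.smoothTransition.contDiff (n := ⊤)).comp
    (contDiff_const.mul (contDiff_id.sub contDiff_const)))

lemma stair_add_int (t : ℝ) (k : ℤ) : stair (t + k) = stair t + k := by
  simp [stair]; ring

lemma abs_stair_sub_le (t : ℝ) : |stair t - t| ≤ 1 := by
  have h1 := Real.smoothTransition.nonneg (10 * Int.fract t)
  have h2 := Real.smoothTransition.le_one (10 * Int.fract t)
  have h3 := Int.fract_nonneg t
  have h4 := (Int.fract_lt_one t).le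
  have h5 := Int.floor_add_fract t
  unfold stair
  rw [abs_le]; constructor <;> linarith

lemma fract_le_of_deriv_stair_ne_zero {t : ℝ} (h : deriv stair t ≠ 0) :
    Int.fract t ≤ 1 / 10 := by
  by_contra hc
  rw [not_le] at hc
  apply h
  have h1 : (⌊t⌋ : ℝ) + 1 / 10 < t := by linarith [Int.floor_add_fract t]
  have : stair =ᶠ[𝓝 t] fun _ => (⌊t⌋ : ℝ) + 1 := by
    filter_upwards [Ioo_mem_nhds h1 (Int.lt_floor_add_one t)] with s hs
    have hf : ⌊s⌋ = ⌊t⌋ := Int.floor_eq_iff.2 ⟨by linarith [hs.1], hs.2⟩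
    simp only [stair, Int.fract, hf]
    rw [Real.smoothTransition.one_of_one_le (by linarith [hs.1])]
  rw [this.deriv_eq]; simp

lemma deriv_stair_add_int (t : ℝ) (k : ℤ) : deriv stair (t + k) = deriv stair t := by
  have : (fun s => stair (s + k)) = fun s => stair s + k := funext fun s => stair_add_int s k
  rw [← deriv_comp_add_const, this, deriv_add_const]

lemma fract_of_deriv_bump_ne_zero {t : ℝ} {k : ℤ} (h : deriv bump (t - k) ≠ 0) :
    3 / 10 ≤ Int.fract t ∧ Int.fract t ≤ 7 / 20 := by
  rcases mem_of_deriv_bump_ne_zero h with ⟨h1, h2⟩ | ⟨h1, h2⟩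
  · have : ⌊t⌋ = k := Int.floor_eq_iff.2 ⟨by linarith, by linarith⟩
    rw [Int.fract, this]; exact ⟨h1, h2⟩
  · have : ⌊t⌋ = k - 1 := Int.floor_eq_iff.2 ⟨by push_cast; linarith, by push_cast; linarith⟩
    rw [Int.fract, this]; push_cast; exact ⟨by linarith, by linarith⟩

/-- The staircases at two consecutive dyadic scales are locally constant wherever one of
the bumps at these two scales varies. -/
lemma deriv_bump_mul_deriv_stair (t : ℝ) (k : ℤ) :
    deriv bump (t - k) * deriv stair t = 0 ∧ deriv bump (t - k) * deriv stair (2 * t) = 0 ∧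
    deriv bump (2 * t - k) * deriv stair t = 0 ∧
    deriv bump (2 * t - k) * deriv stair (2 * t) = 0 := by
  have hft : Int.fract t = t - ⌊t⌋ := rfl
  have hf2 : Int.fract (2 * t) = 2 * t - ⌊2 * t⌋ := rfl
  have key : ∀ m : ℤ, 2 * Int.fract t - Int.fract (2 * t) = m → m = 0 ∨ m = 1 := by
    intro m hm
    have h1 := Int.fract_nonneg t
    have h2 := Int.fract_lt_one t
    have h3 := Int.fract_nonneg (2 * t)
    have h4 := Int.fract_lt_one (2 * t)
    have h5 : (-1 : ℝ) < m := by linarith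
    have h6 : (m : ℝ) < 2 := by linarith
    have h7 : (-1 : ℤ) < m := by exact_mod_cast h5
    have h8 : m < 2 := by exact_mod_cast h6
    omega
  have hm := key (⌊2 * t⌋ - 2 * ⌊t⌋) (by rw [hft, hf2]; push_cast; ring)
  have hm' : 2 * Int.fract t - Int.fract (2 * t) = ((⌊2 * t⌋ - 2 * ⌊t⌋ : ℤ) : ℝ) := by
    rw [hft, hf2]; push_cast; ring
  have h1 := Int.fract_nonneg t
  have h3 := Int.fract_nonneg (2 * t)
  refine ⟨?_, ?_, ?_, ?_⟩ <;> by_contra hc <;> obtain ⟨ha, hb⟩ := mul_ne_zero_iff.1 hc <;>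
    have hA := fract_of_deriv_bump_ne_zero ha <;>
    have hB := fract_le_of_deriv_stair_ne_zero hb <;>
    rcases hm with hm | hm <;> rw [hm] at hm' <;> push_cast at hm' <;> linarith

/-! ### Interpolation of nodal values at one and at two scales -/

/-- `ℝⁿ` with the supremum norm. -/
abbrev Vec (n : ℕ) := Fin n → ℝ

/-- The dual of `Vec n`. -/
abbrev CoVec (n : ℕ) := Vec n →L[ℝ] ℝ

variable {n : ℕ} {E : Type*} [NormedAddCommGroup E] [NormedSpace ℝ E]

/-- The tensor product bump centred at the lattice point `κ`. -/
def node (κ : Fin n → ℤ) (v : Vec n) : ℝ := ∏ i, bump (v i - κ i)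

/-- The lattice points of the window `{-1, …, 3}ⁿ`. -/
def off (e : Fin n → Fin 5) : Fin n → ℤ := fun i => ((e i : ℕ) : ℤ) - 1

/-- Interpolation of values given on the lattice window. -/
def win (g : (Fin n → Fin 5) → E) (v : Vec n) : E := ∑ e, node (off e) v • g e

/-- Interpolation of values given at the scales `1` and `1/2`; the weight `w` selects the
finer scale. -/
def twoScale (w : (Fin n → Fin 5) → ℝ) (g₁ g₂ : (Fin n → Fin 5) → E) (v : Vec n) : E :=
  win (fun e => (1 - w e) • g₁ e) v + win w v • win g₂ ((2 : ℝ) • v)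

/-- The bounded displacement `v - stair v`, blended between the scales `1` and `1/2`. -/
def displacement (b : ℝ) (v : Vec n) : Vec n :=
  fun i => v i - ((1 - b) * stair (v i) + b * (stair (2 * v i) / 2))

/-- The diagonal part of the derivative of the blended staircase. -/
def slope (b : ℝ) (v : Vec n) : Vec n →L[ℝ] Vec n :=
  ContinuousLinearMap.pi fun i =>
    ((1 - b) * deriv stair (v i) + b * deriv stair (2 * v i)) •
      (ContinuousLinearMap.proj i : Vec n →L[ℝ] ℝ)

/-- The difference between the staircases of scales `1/2` and `1`. -/
def stairGap (v : Vec n) : Vec n := fun i => stair (2 * v i) / 2 - stair (v i)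

/-- The momentum coordinate of the jet with base map `X`: the covector field `p`, corrected so
that the one-form `p dX + dC + X dp` becomes a multiple of `dX`. -/
def momentum (A : ℝ) (X : Vec n → Vec n) (C : Vec n → ℝ) (p : Vec n → CoVec n)
    (R : Vec n → Vec n →L[ℝ] Vec n) (u : Vec n) : CoVec n :=
  p u + (fderiv ℝ C u + (fderiv ℝ p u).flip (X u)) ∘L Ring.inverse (fderiv ℝ X u + A • R u)

lemma contDiff_node (κ : Fin n → ℤ) : ContDiff ℝ ∞ (node κ) := by
  unfold node
  refine contDiff_prod fun i _ => ?_
  exact contDiff_bump.comp ((contDiff_apply ℝ ℝ i).sub contDiff_const)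

lemma contDiff_win (g : (Fin n → Fin 5) → E) : ContDiff ℝ ∞ (win g) := by
  unfold win
  exact ContDiff.sum fun e _ => (contDiff_node (off e)).smul contDiff_const

lemma contDiff_twoScale (w : (Fin n → Fin 5) → ℝ) (g₁ g₂ : (Fin n → Fin 5) → E) :
    ContDiff ℝ ∞ (twoScale w g₁ g₂) := by
  unfold twoScale
  exact (contDiff_win _).add ((contDiff_win _).smul
    ((contDiff_win _).comp (contDiff_const_smul _)))

lemma hasFDerivAt_node (κ : Fin n → ℤ) (v : Vec n) :
    HasFDerivAt (node κ) (∑ i, (∏ j ∈ Finset.univ.erase i, bump (v j - κ j)) •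
      (deriv bump (v i - κ i) • (ContinuousLinearMap.proj i : Vec n →L[ℝ] ℝ))) v := by
  classical
  unfold node
  refine HasFDerivAt.finsetProd (𝔸' := ℝ) (g := fun i (v : Vec n) => bump (v i - κ i)) ?_
  intro i _
  have h1 : HasDerivAt bump (deriv bump (v i - κ i)) (v i - κ i) :=
    ((contDiff_bump.differentiable (by simp)) _).hasDerivAt
  have h2 : HasFDerivAt (fun v : Vec n => v i - (κ i : ℝ))
      (ContinuousLinearMap.proj i : Vec n →L[ℝ] ℝ) v :=
    (ContinuousLinearMap.proj (R := ℝ) (φ := fun _ : Fin n => ℝ) i).hasFDerivAt.sub_const _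
  exact h1.comp_hasFDerivAt v h2

lemma fderiv_node_mul (κ : Fin n → ℤ) (v a x : Vec n)
    (h : ∀ i, deriv bump (v i - κ i) * a i = 0) :
    fderiv ℝ (node κ) v (fun i => a i * x i) = 0 := by
  rw [(hasFDerivAt_node κ v).fderiv]
  simp only [_root_.sum_apply, _root_.smul_apply,
    ContinuousLinearMap.proj_apply, smul_eq_mul]
  refine Finset.sum_eq_zero fun i _ => ?_
  rw [← mul_assoc (deriv bump _), h i]; simp

lemma fderiv_win_apply (g : (Fin n → Fin 5) → E) (v x : Vec n) :
    fderiv ℝ (win g) v x = ∑ e, fderiv ℝ (node (off e)) v x • g e := by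
  have : HasFDerivAt (win g)
      (∑ e, (fderiv ℝ (node (off e)) v).smulRight (g e)) v := by
    unfold win
    refine HasFDerivAt.fun_sum fun e _ => ?_
    exact (((contDiff_node (off e)).differentiable (by simp)) v).hasFDerivAt.smul_const (g e)
  rw [this.fderiv]
  simp

lemma fderiv_twoScale_apply (w : (Fin n → Fin 5) → ℝ) (g₁ g₂ : (Fin n → Fin 5) → E)
    (v x : Vec n) :
    fderiv ℝ (twoScale w g₁ g₂) v x = fderiv ℝ (win fun e => (1 - w e) • g₁ e) v x +
      (win w v • (2 : ℝ) • fderiv ℝ (win g₂) ((2 : ℝ) • v) x +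
        fderiv ℝ (win w) v x • win g₂ ((2 : ℝ) • v)) := by
  have d : ∀ {F : Type _} [NormedAddCommGroup F] [NormedSpace ℝ F]
      (g : (Fin n → Fin 5) → F) (y : Vec n), HasFDerivAt (win g) (fderiv ℝ (win g) y) y :=
    fun g y => ((contDiff_win g).differentiable (by simp) y).hasFDerivAt
  have h2 : HasFDerivAt (fun y : Vec n => (2 : ℝ) • y)
      ((2 : ℝ) • ContinuousLinearMap.id ℝ (Vec n)) v :=
    ((2 : ℝ) • ContinuousLinearMap.id ℝ (Vec n)).hasFDerivAt
  have h3 := (d g₂ ((2 : ℝ) • v)).comp v h2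
  have := (((contDiff_win fun e => (1 - w e) • g₁ e).differentiable
    (by simp) v).hasFDerivAt).add (((contDiff_win w).differentiable
    (by simp) v).hasFDerivAt.smul h3)
  have h4 : HasFDerivAt (twoScale w g₁ g₂) _ v := this
  rw [h4.fderiv]
  simp

lemma slope_apply (b : ℝ) (v x : Vec n) :
    slope b v x = fun i => ((1 - b) * deriv stair (v i) + b * deriv stair (2 * v i)) * x i := by
  ext i; simp [slope]

lemma fderiv_win_slope (g : (Fin n → Fin 5) → E) (b : ℝ) (v x : Vec n) :
    fderiv ℝ (win g) v (slope b v x) = 0 := by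
  rw [fderiv_win_apply, slope_apply]
  refine Finset.sum_eq_zero fun e _ => ?_
  rw [fderiv_node_mul, zero_smul]
  intro i
  obtain ⟨h1, h2, -, -⟩ := deriv_bump_mul_deriv_stair (v i) (off e i)
  linear_combination (1 - b) * h1 + b * h2

lemma fderiv_win_two_slope (g : (Fin n → Fin 5) → E) (b : ℝ) (v x : Vec n) :
    fderiv ℝ (win g) ((2 : ℝ) • v) (slope b v x) = 0 := by
  rw [fderiv_win_apply, slope_apply]
  refine Finset.sum_eq_zero fun e _ => ?_
  rw [fderiv_node_mul, zero_smul]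
  intro i
  obtain ⟨-, -, h1, h2⟩ := deriv_bump_mul_deriv_stair (v i) (off e i)
  simp only [Pi.smul_apply, smul_eq_mul]
  linear_combination (1 - b) * h1 + b * h2

lemma fderiv_twoScale_slope (w : (Fin n → Fin 5) → ℝ) (g₁ g₂ : (Fin n → Fin 5) → E)
    (b : ℝ) (v x : Vec n) : fderiv ℝ (twoScale w g₁ g₂) v (slope b v x) = 0 := by
  rw [fderiv_twoScale_apply, fderiv_win_slope, fderiv_win_slope, fderiv_win_two_slope]
  simp

lemma hasFDerivAt_displacement {b : Vec n → ℝ} {b' : CoVec n} {v : Vec n}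
    (hb : HasFDerivAt b b' v) :
    HasFDerivAt (fun v => displacement (b v) v)
      (ContinuousLinearMap.id ℝ (Vec n) - slope (b v) v - b'.smulRight (stairGap v)) v := by
  rw [hasFDerivAt_pi']
  intro i
  have ds : Differentiable ℝ stair := contDiff_stair.differentiable (by simp)
  have hp : HasFDerivAt (fun v : Vec n => v i) (ContinuousLinearMap.proj i : CoVec n) v :=
    (ContinuousLinearMap.proj (R := ℝ) (φ := fun _ : Fin n => ℝ) i).hasFDerivAt
  have h1 := (ds (v i)).hasDerivAt.comp_hasFDerivAt v hp
  have h2 := (ds (2 * v i)).hasDerivAt.comp_hasFDerivAt v (hp.const_mul 2)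
  have h3 := hp.sub (((hb.const_sub (1 : ℝ)).mul h1).add (hb.mul (h2.mul_const (1 / 2 : ℝ))))
  have h4 : (fun v : Vec n => displacement (b v) v i) =ᶠ[𝓝 v]
      fun v => v i - ((1 - b v) * stair (v i) + b v * (stair (2 * v i) * (1 / 2))) :=
    Eventually.of_forall fun y => by simp only [displacement]; ring
  refine HasFDerivAt.congr_fderiv (HasFDerivAt.congr_of_eventuallyEq h3 h4) ?_
  ext x
  simp [slope, stairGap]
  ring

/-- Solving for the momentum: if `τ`, `b'` and `D` vanish on the range of the slope `R`, then
`τ` is a multiple of the derivative of the base map. -/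
lemma comp_inverse_comp_eq {A : ℝ} {D R : Vec n →L[ℝ] Vec n} {b' τ : CoVec n}
    {c : Vec n} {X' : Vec n →L[ℝ] Vec n} (hA : A ≠ 0)
    (hX : X' = D + A • (ContinuousLinearMap.id ℝ (Vec n) - R - b'.smulRight c))
    (hu : IsUnit (X' + A • R)) (hτ : ∀ x, τ (R x) = 0) (hb : ∀ x, b' (R x) = 0)
    (hD : ∀ x, D (R x) = 0) :
    (τ ∘L Ring.inverse (X' + A • R)) ∘L X' = τ := by
  have hG : ∀ x, Ring.inverse (X' + A • R) ((X' + A • R) x) = x := by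
    intro x
    have := Ring.inverse_mul_cancel _ hu
    exact congrArg (fun T : Vec n →L[ℝ] Vec n => T x) this
  have hR : ∀ x, (X' + A • R) (R x) = A • R x := by
    intro x
    rw [hX]
    simp [hD, hb, ← smul_add]
  have h0 : ∀ x, τ (Ring.inverse (X' + A • R) (R x)) = 0 := by
    intro x
    have h1 := congrArg τ (hG (R x))
    rw [hR, map_smul, map_smul, hτ, smul_eq_mul] at h1
    exact (mul_eq_zero.1 h1).resolve_left hA
  ext1 x
  have h1 := congrArg τ (hG x)
  simp only [_root_.add_apply, _root_.smul_apply, map_add, map_smul,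
    h0, smul_zero, add_zero] at h1
  exact h1

lemma isUnit_of_small {A : ℝ} {D : Vec n →L[ℝ] Vec n} {b' : CoVec n} {c : Vec n} (hA : 0 < A)
    (hD : ‖D‖ ≤ A / 4) (hb : ‖b'‖ * ‖c‖ ≤ 1 / 4) :
    IsUnit (D + A • (ContinuousLinearMap.id ℝ (Vec n) - b'.smulRight c)) := by
  have h1 : D + A • (ContinuousLinearMap.id ℝ (Vec n) - b'.smulRight c) =
      (A • (1 : Vec n →L[ℝ] Vec n)) * (1 - (b'.smulRight c - A⁻¹ • D)) := by
    ext1 x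
    simp [smul_sub, smul_smul, hA.ne']
    abel
  rw [h1]
  refine IsUnit.mul ?_ (isUnit_one_sub_of_norm_lt_one ?_)
  · have := (isUnit_one (M := Vec n →L[ℝ] Vec n)).smul (Units.mk0 A hA.ne')
    exact this
  · refine lt_of_le_of_lt (norm_sub_le _ _) ?_
    rw [ContinuousLinearMap.norm_smulRight_apply, norm_smul, norm_inv, Real.norm_of_nonneg hA.le]
    have : A⁻¹ * ‖D‖ ≤ 1 / 4 := by
      rw [inv_mul_le_iff₀ hA]; linarith
    linarith

variable {n : ℕ} {E : Type*} [NormedAddCommGroup E] [NormedSpace ℝ E]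

/-! ### Uniform bounds at unit scale -/

/-- Weights, base points, momenta and constant terms at the nodes of the lattice window, at the
scales `1` and `1/2`. -/
abbrev NodeData (n : ℕ) :=
  ((Fin n → Fin 5) → ℝ) × (((Fin n → Fin 5) → Vec n) × ((Fin n → Fin 5) → Vec n)) ×
    (((Fin n → Fin 5) → CoVec n) × ((Fin n → Fin 5) → CoVec n)) ×
      (((Fin n → Fin 5) → ℝ) × ((Fin n → Fin 5) → ℝ))

/-- The base map built from nodal data at unit scale. -/
def unitBase (A : ℝ) (d : NodeData n) (v : Vec n) : Vec n :=
  twoScale d.1 d.2.1.1 d.2.1.2 v + A • displacement (win d.1 v) v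

/-- The interpolated momenta at unit scale. -/
def unitMean (d : NodeData n) (v : Vec n) : CoVec n := twoScale d.1 d.2.2.1.1 d.2.2.1.2 v

/-- The interpolated constant terms at unit scale. -/
def unitConst (d : NodeData n) (v : Vec n) : ℝ := twoScale d.1 d.2.2.2.1 d.2.2.2.2 v

/-- The momentum coordinate at unit scale. -/
def unitMomentum (A : ℝ) (d : NodeData n) (v : Vec n) : CoVec n :=
  momentum A (unitBase A d) (unitConst d) (unitMean d) (fun v => slope (win d.1 v) v) v

section Joint

variable {P : Type*} [NormedAddCommGroup P] [NormedSpace ℝ P]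

lemma contDiff_win_param {g : P → (Fin n → Fin 5) → E} {v : P → Vec n}
    (hg : ContDiff ℝ ∞ g) (hv : ContDiff ℝ ∞ v) : ContDiff ℝ ∞ fun z => win (g z) (v z) := by
  unfold win
  exact ContDiff.sum fun e _ => ((contDiff_node (off e)).comp hv).smul
    ((contDiff_pi.1 hg) e)

lemma contDiff_twoScale_param {w : P → (Fin n → Fin 5) → ℝ} {g₁ g₂ : P → (Fin n → Fin 5) → E}
    {v : P → Vec n} (hw : ContDiff ℝ ∞ w) (h₁ : ContDiff ℝ ∞ g₁) (h₂ : ContDiff ℝ ∞ g₂)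
    (hv : ContDiff ℝ ∞ v) : ContDiff ℝ ∞ fun z => twoScale (w z) (g₁ z) (g₂ z) (v z) := by
  unfold twoScale
  refine (contDiff_win_param (contDiff_pi.2 fun e => ?_) hv).add
    ((contDiff_win_param hw hv).smul
      (contDiff_win_param h₂ ((contDiff_const_smul (2 : ℝ)).comp hv)))
  exact (contDiff_const.sub (contDiff_pi.1 hw e)).smul (contDiff_pi.1 h₁ e)

lemma contDiff_displacement_param {b : P → ℝ} {v : P → Vec n}
    (hb : ContDiff ℝ ∞ b) (hv : ContDiff ℝ ∞ v) :
    ContDiff ℝ ∞ fun z => displacement (b z) (v z) := by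
  unfold displacement
  refine contDiff_pi.2 fun i => ?_
  have hvi := contDiff_pi.1 hv i
  exact hvi.sub (((contDiff_const.sub hb).mul (contDiff_stair.comp hvi)).add
    (hb.mul ((contDiff_stair.comp (contDiff_const.mul hvi)).div_const 2)))

lemma contDiff_slope_param {b : P → ℝ} {v : P → Vec n}
    (hb : ContDiff ℝ ∞ b) (hv : ContDiff ℝ ∞ v) :
    ContDiff ℝ ∞ fun z => slope (b z) (v z) := by
  have : (fun z => slope (b z) (v z)) = fun z => ∑ i : Fin n,
      ((1 - b z) * deriv stair (v z i) + b z * deriv stair (2 * v z i)) •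
        ((ContinuousLinearMap.proj i : CoVec n).smulRight (Pi.single i (1 : ℝ) : Vec n)) := by
    funext z
    ext x j
    simp [slope, _root_.sum_apply, Finset.sum_apply, Pi.single_apply]
  rw [this]
  have hd : ContDiff ℝ ∞ (deriv stair) := (contDiff_infty_iff_deriv.1 contDiff_stair).2
  refine ContDiff.sum fun i _ => ContDiff.smul (f := fun z => (1 - b z) * deriv stair (v z i) +
    b z * deriv stair (2 * v z i)) ?_ contDiff_const
  have hvi := contDiff_pi.1 hv i
  exact ((contDiff_const.sub hb).mul (hd.comp hvi)).add
    (hb.mul (hd.comp (contDiff_const.mul hvi)))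

end Joint

lemma contDiff_unitBase (A : ℝ) :
    ContDiff ℝ ∞ fun z : NodeData n × Vec n => unitBase A z.1 z.2 := by
  unfold unitBase
  refine (contDiff_twoScale_param ?_ ?_ ?_ ?_).add
    ((contDiff_const_smul A).comp
      (contDiff_displacement_param (contDiff_win_param ?_ ?_) ?_)) <;> fun_prop

lemma contDiff_unitMean :
    ContDiff ℝ ∞ fun z : NodeData n × Vec n => unitMean z.1 z.2 := by
  unfold unitMean
  refine contDiff_twoScale_param ?_ ?_ ?_ ?_ <;> fun_prop

lemma contDiff_unitConst :
    ContDiff ℝ ∞ fun z : NodeData n × Vec n => unitConst z.1 z.2 := by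
  unfold unitConst
  refine contDiff_twoScale_param ?_ ?_ ?_ ?_ <;> fun_prop

lemma contDiff_partial_fderiv {P F G : Type*} [NormedAddCommGroup P] [NormedSpace ℝ P]
    [NormedAddCommGroup F] [NormedSpace ℝ F] [NormedAddCommGroup G] [NormedSpace ℝ G]
    {f : P → F → G} (hf : ContDiff ℝ ∞ fun z : P × F => f z.1 z.2) :
    ContDiff ℝ ∞ fun z : P × F => fderiv ℝ (f z.1) z.2 := by
  refine ContDiff.fderiv (m := ∞) (f := fun (z : P × F) (v : F) => f z.1 v) ?_ contDiff_snd
    (by simp)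
  exact hf.comp (f := fun q : (P × F) × F => (q.1.1, q.2)) (by fun_prop)

lemma contDiff_flip : ContDiff ℝ ∞ fun B : Vec n →L[ℝ] CoVec n => B.flip := by
  refine IsBoundedLinearMap.contDiff (𝕜 := ℝ)
    (IsLinearMap.with_bound ⟨fun B B' => ?_, fun c B => ?_⟩ 1 fun B => ?_)
  · ext x y; simp
  · ext x y; simp
  · rw [ContinuousLinearMap.opNorm_flip, one_mul]

lemma contDiffAt_unitMomentum {A : ℝ} {z : NodeData n × Vec n}
    (hu : IsUnit (fderiv ℝ (unitBase A z.1) z.2 + A • slope (win z.1.1 z.2) z.2)) :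
    ContDiffAt ℝ ∞ (fun z : NodeData n × Vec n => unitMomentum A z.1 z.2) z := by
  have h1 := contDiff_partial_fderiv (contDiff_unitBase (n := n) A)
  have h2 := contDiff_partial_fderiv (contDiff_unitMean (n := n))
  have h3 := contDiff_partial_fderiv (contDiff_unitConst (n := n))
  have h4 : ContDiff ℝ ∞ fun z : NodeData n × Vec n => slope (win z.1.1 z.2) z.2 :=
    contDiff_slope_param (contDiff_win_param (by fun_prop) (by fun_prop)) (by fun_prop)
  have h5 : ContDiff ℝ ∞ fun z : NodeData n × Vec n => (fderiv ℝ (unitMean z.1) z.2).flip :=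
    contDiff_flip.comp h2
  obtain ⟨U, hU⟩ := hu
  have h6 := contDiffAt_ringInverse ℝ (n := ∞) U
  rw [hU] at h6
  have h8 : ContDiff ℝ ∞ fun z : NodeData n × Vec n =>
      fderiv ℝ (unitBase A z.1) z.2 + A • slope (win z.1.1 z.2) z.2 :=
    h1.add ((contDiff_const_smul A).comp h4)
  have h7 : ContDiffAt ℝ ∞ (fun z : NodeData n × Vec n =>
      Ring.inverse (fderiv ℝ (unitBase A z.1) z.2 + A • slope (win z.1.1 z.2) z.2)) z :=
    ContDiffAt.comp z (g := Ring.inverse) h6 h8.contDiffAt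
  have h9 : ContDiff ℝ ∞ fun z : NodeData n × Vec n =>
      fderiv ℝ (unitConst z.1) z.2 + (fderiv ℝ (unitMean z.1) z.2).flip (unitBase A z.1 z.2) :=
    h3.add (h5.clm_apply (contDiff_unitBase A))
  exact contDiff_unitMean.contDiffAt.add (h9.contDiffAt.clm_comp h7)

lemma contDiffAt_unitMomentum_right {A : ℝ} {d : NodeData n} {v : Vec n}
    (hu : IsUnit (fderiv ℝ (unitBase A d) v + A • slope (win d.1 v) v)) :
    ContDiffAt ℝ ∞ (unitMomentum A d) v := by
  have h1 := contDiffAt_unitMomentum (z := (d, v)) hu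
  have h2 : ContDiffAt ℝ ∞ (fun v : Vec n => (d, v)) v := by fun_prop
  have h3 := ContDiffAt.comp v h1 h2
  exact h3

lemma sum_node {v : Vec n} (h : ∀ i, -1 ≤ v i ∧ v i ≤ 3) :
    ∑ e : Fin n → Fin 5, node (off e) v = 1 := by
  have := Finset.prod_univ_sum (fun _ : Fin n => (Finset.univ : Finset (Fin 5)))
    (fun i k => bump (v i - (((k : ℕ) : ℤ) - 1 : ℤ)))
  rw [Fintype.piFinset_univ] at this
  unfold node off
  rw [← this]
  exact Finset.prod_eq_one fun i _ => sum_bump_window (h i).1 (h i).2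

lemma sum_fderiv_node {v : Vec n} (h : v ∈ Set.Icc (0 : Vec n) 1) :
    ∑ e : Fin n → Fin 5, fderiv ℝ (node (off e)) v = 0 := by
  have h1 : HasFDerivAt (fun v => ∑ e : Fin n → Fin 5, node (off e) v)
      (∑ e : Fin n → Fin 5, fderiv ℝ (node (off e)) v) v :=
    HasFDerivAt.fun_sum fun e _ =>
      (((contDiff_node (off e)).differentiable (by simp)) v).hasFDerivAt
  have h2 : (fun v => ∑ e : Fin n → Fin 5, node (off e) v) =ᶠ[𝓝 v] fun _ => 1 := by
    have : ∀ᶠ u in 𝓝 v, ∀ i, -1 < u i ∧ u i < 3 := by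
      rw [eventually_all]
      intro i
      have hc : Tendsto (fun u : Vec n => u i) (𝓝 v) (𝓝 (v i)) := (continuous_apply i).tendsto v
      have h0 := h.1 i
      have h1 := h.2 i
      simp only [Pi.zero_apply, Pi.one_apply] at h0 h1
      exact hc.eventually (Ioo_mem_nhds (by linarith) (by linarith))
    filter_upwards [this] with u hu
    exact sum_node fun i => ⟨(hu i).1.le, (hu i).2.le⟩
  rw [← h1.fderiv, h2.fderiv_eq]
  simp

lemma norm_stairGap_le (v : Vec n) : ‖stairGap v‖ ≤ 3 / 2 := by
  rw [pi_norm_le_iff_of_nonneg (by norm_num)]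
  intro i
  have h1 := abs_le.1 (abs_stair_sub_le (v i))
  have h2 := abs_le.1 (abs_stair_sub_le (2 * v i))
  simp only [stairGap, Real.norm_eq_abs]
  rw [abs_le]
  constructor <;> linarith [h1.1, h1.2, h2.1, h2.2]

lemma exists_small_oscillation (n : ℕ) : ∃ ε : ℝ, 0 < ε ∧ ∀ w : (Fin n → Fin 5) → ℝ,
    (∀ e e', |w e - w e'| ≤ ε) → ∀ v ∈ Set.Icc (0 : Vec n) 1,
      ‖fderiv ℝ (win w) v‖ * ‖stairGap v‖ ≤ 1 / 4 := by
  have hc : ∀ e : Fin n → Fin 5, ∃ C, ∀ v ∈ Set.Icc (0 : Vec n) 1,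
      ‖fderiv ℝ (node (off e)) v‖ ≤ C := fun e =>
    isCompact_Icc.exists_bound_of_continuousOn
      ((contDiff_node (off e)).continuous_fderiv (by simp)).continuousOn
  choose C hC using hc
  set S : ℝ := ∑ e, |C e| + 1 with hS
  have hS0 : 0 < S := by positivity
  refine ⟨1 / (6 * S), by positivity, fun w hw v hv => ?_⟩
  let e₀ : Fin n → Fin 5 := fun _ => 0
  have h1 : fderiv ℝ (win w) v = ∑ e, (w e - w e₀) • fderiv ℝ (node (off e)) v := by
    have : ∑ e, w e₀ • fderiv ℝ (node (off e)) v = 0 := by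
      rw [← Finset.smul_sum, sum_fderiv_node hv, smul_zero]
    have h0 : ∑ e, (w e - w e₀) • fderiv ℝ (node (off e)) v =
        ∑ e, w e • fderiv ℝ (node (off e)) v := by
      rw [← sub_zero (∑ e, w e • _), ← this, ← Finset.sum_sub_distrib]
      refine Finset.sum_congr rfl fun e _ => ?_
      ext1 x
      simp [sub_mul]
    rw [h0]
    ext1 x
    rw [fderiv_win_apply]
    simp [_root_.sum_apply, mul_comm]
  have h2 : ‖fderiv ℝ (win w) v‖ ≤ 1 / 6 := by
    rw [h1]
    calc _ ≤ ∑ e, 1 / (6 * S) * |C e| := by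
          refine norm_sum_le_of_le _ fun e _ => ?_
          rw [norm_smul]
          exact mul_le_mul (hw e e₀) ((hC e v hv).trans (le_abs_self _)) (norm_nonneg _)
            (by positivity)
      _ = 1 / (6 * S) * (S - 1) := by rw [← Finset.mul_sum, hS]; ring
      _ ≤ 1 / (6 * S) * S := by gcongr; linarith
      _ = 1 / 6 := by field_simp
  calc ‖fderiv ℝ (win w) v‖ * ‖stairGap v‖ ≤ 1 / 6 * (3 / 2) := by
        exact mul_le_mul h2 (norm_stairGap_le v) (norm_nonneg _) (by norm_num)
    _ = 1 / 4 := by norm_num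

lemma fderiv_unitBase (A : ℝ) (d : NodeData n) (v : Vec n) :
    fderiv ℝ (unitBase A d) v = fderiv ℝ (twoScale d.1 d.2.1.1 d.2.1.2) v +
      A • (ContinuousLinearMap.id ℝ (Vec n) - slope (win d.1 v) v -
        (fderiv ℝ (win d.1) v).smulRight (stairGap v)) := by
  have h1 := ((contDiff_twoScale d.1 d.2.1.1 d.2.1.2).differentiable (by simp) v).hasFDerivAt
  have h2 := hasFDerivAt_displacement
    ((contDiff_win d.1).differentiable (by simp) v).hasFDerivAt
  exact (h1.add (h2.const_smul A)).fderiv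

lemma fderiv_unitConst_slope (d : NodeData n) (b : ℝ) (v x : Vec n) :
    fderiv ℝ (unitConst d) v (slope b v x) = 0 := by
  have : unitConst d = twoScale d.1 d.2.2.2.1 d.2.2.2.2 := rfl
  rw [this]
  exact fderiv_twoScale_slope _ _ _ _ _ _

lemma fderiv_unitMean_slope (d : NodeData n) (b : ℝ) (v x : Vec n) :
    fderiv ℝ (unitMean d) v (slope b v x) = 0 := by
  have : unitMean d = twoScale d.1 d.2.2.1.1 d.2.2.1.2 := rfl
  rw [this]
  exact fderiv_twoScale_slope _ _ _ _ _ _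

/-- The properties, at a point `v`, of the unit-scale jet built from the data `d`. -/
structure UnitBounds (A M : ℝ) (d : NodeData n) (v : Vec n) : Prop where
  contact : fderiv ℝ (unitConst d) v + (fderiv ℝ (unitMean d) v).flip (unitBase A d v) +
    unitMean d v ∘L fderiv ℝ (unitBase A d) v =
      unitMomentum A d v ∘L fderiv ℝ (unitBase A d) v
  differentiable : DifferentiableAt ℝ (unitMomentum A d) v
  base_le : ‖unitBase A d v‖ ≤ M
  momentum_le : ‖unitMomentum A d v‖ ≤ M
  mean_le : ‖unitMean d v‖ ≤ M
  const_le : |unitConst d v| ≤ M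
  fderiv_base_le : ‖fderiv ℝ (unitBase A d) v‖ ≤ M
  fderiv_momentum_le : ‖fderiv ℝ (unitMomentum A d) v‖ ≤ M

lemma contact_unit {A : ℝ} {d : NodeData n} {v : Vec n} (hA : A ≠ 0)
    (hu : IsUnit (fderiv ℝ (unitBase A d) v + A • slope (win d.1 v) v)) :
    fderiv ℝ (unitConst d) v + (fderiv ℝ (unitMean d) v).flip (unitBase A d v) +
      unitMean d v ∘L fderiv ℝ (unitBase A d) v =
        unitMomentum A d v ∘L fderiv ℝ (unitBase A d) v := by
  have h1 := comp_inverse_comp_eq (R := slope (win d.1 v) v)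
    (τ := fderiv ℝ (unitConst d) v + (fderiv ℝ (unitMean d) v).flip (unitBase A d v))
    hA (fderiv_unitBase A d v) hu ?_ (fun x => fderiv_win_slope _ _ _ _)
    (fun x => fderiv_twoScale_slope _ _ _ _ _ _)
  · rw [unitMomentum, momentum, ContinuousLinearMap.add_comp, h1, add_comm]
  · intro x
    have e1 := fderiv_unitConst_slope d (win d.1 v) v x
    have e2 := fderiv_unitMean_slope d (win d.1 v) v x
    rw [_root_.add_apply, ContinuousLinearMap.flip_apply, e1, e2]
    simp

/-- Uniform bounds for the unit-scale jets, provided the weights oscillate little. -/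
theorem exists_unitBounds (n : ℕ) : ∃ ε : ℝ, 0 < ε ∧ ∀ C₀ : ℝ, ∃ A M : ℝ, 0 < A ∧ 0 ≤ M ∧
    ∀ d : NodeData n, ‖d‖ ≤ C₀ → (∀ e e', |d.1 e - d.1 e'| ≤ ε) →
      ∀ v ∈ Set.Icc (0 : Vec n) 1, UnitBounds A M d v := by
  obtain ⟨ε, hε, hosc⟩ := exists_small_oscillation n
  refine ⟨ε, hε, fun C₀ => ?_⟩
  have hK1 : IsCompact (Metric.closedBall (0 : NodeData n) C₀ ×ˢ Set.Icc (0 : Vec n) 1) :=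
    (isCompact_closedBall _ _).prod isCompact_Icc
  have hts : ContDiff ℝ ∞ fun z : NodeData n × Vec n =>
      fderiv ℝ (twoScale z.1.1 z.1.2.1.1 z.1.2.1.2) z.2 := by
    refine contDiff_partial_fderiv (f := fun (d : NodeData n) v =>
      twoScale d.1 d.2.1.1 d.2.1.2 v) ?_
    refine contDiff_twoScale_param ?_ ?_ ?_ ?_ <;> fun_prop
  obtain ⟨C₁, hC₁⟩ := hK1.exists_bound_of_continuousOn hts.continuous.continuousOn
  set A : ℝ := 4 * |C₁| + 1 with hAdef
  have hA : 0 < A := by positivity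
  set K : Set (NodeData n × Vec n) :=
    (Metric.closedBall (0 : NodeData n) C₀ ×ˢ Set.Icc (0 : Vec n) 1) ∩
      {z | ∀ e e', |z.1.1 e - z.1.1 e'| ≤ ε} with hKdef
  have hK : IsCompact K := by
    refine hK1.inter_right ?_
    simp only [Set.ofPred_forall]
    refine isClosed_iInter fun e => isClosed_iInter fun e' => ?_
    exact isClosed_le (by fun_prop) continuous_const
  have hunit : ∀ z ∈ K,
      IsUnit (fderiv ℝ (unitBase A z.1) z.2 + A • slope (win z.1.1 z.2) z.2) := by
    intro z hz
    have h1 := isUnit_of_small (D := fderiv ℝ (twoScale z.1.1 z.1.2.1.1 z.1.2.1.2) z.2) hA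
      ((hC₁ z hz.1).trans (by rw [hAdef]; linarith [le_abs_self C₁]))
      (hosc z.1.1 hz.2 z.2 hz.1.2)
    rw [fderiv_unitBase]
    convert h1 using 1
    module
  have hm : ∀ z ∈ K, ContDiffAt ℝ ∞ (fun z : NodeData n × Vec n => unitMomentum A z.1 z.2) z :=
    fun z hz => contDiffAt_unitMomentum (hunit z hz)
  have hm' : ∀ z ∈ K, ContinuousAt
      (fun z : NodeData n × Vec n => fderiv ℝ (unitMomentum A z.1) z.2) z := by
    intro z hz
    have h1 : ContDiffAt ℝ ∞ (fun q : (NodeData n × Vec n) × Vec n =>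
        unitMomentum A q.1.1 q.2) (z, z.2) :=
      ContDiffAt.comp (z, z.2) (f := fun q : (NodeData n × Vec n) × Vec n => (q.1.1, q.2))
        (g := fun z : NodeData n × Vec n => unitMomentum A z.1 z.2) (hm z hz) (by fun_prop)
    exact (ContDiffAt.fderiv (m := 0) (f := fun (z : NodeData n × Vec n) v => unitMomentum A z.1 v)
      h1 contDiffAt_snd (by simp)).continuousAt
  obtain ⟨M₁, hM₁⟩ := hK.exists_bound_of_continuousOn
    (contDiff_unitBase (n := n) A).continuous.continuousOn
  obtain ⟨M₂, hM₂⟩ := hK.exists_bound_of_continuousOn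
    (f := fun z : NodeData n × Vec n => unitMomentum A z.1 z.2)
    fun z hz => (hm z hz).continuousAt.continuousWithinAt
  obtain ⟨M₃, hM₃⟩ := hK.exists_bound_of_continuousOn
    (contDiff_unitMean (n := n)).continuous.continuousOn
  obtain ⟨M₄, hM₄⟩ := hK.exists_bound_of_continuousOn
    (contDiff_unitConst (n := n)).continuous.continuousOn
  obtain ⟨M₅, hM₅⟩ := hK.exists_bound_of_continuousOn
    (contDiff_partial_fderiv (contDiff_unitBase (n := n) A)).continuous.continuousOn
  obtain ⟨M₆, hM₆⟩ := hK.exists_bound_of_continuousOn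
    (f := fun z : NodeData n × Vec n => fderiv ℝ (unitMomentum A z.1) z.2)
    fun z hz => (hm' z hz).continuousWithinAt
  refine ⟨A, |M₁| + |M₂| + |M₃| + |M₄| + |M₅| + |M₆|, hA, by positivity,
    fun d hd hw v hv => ?_⟩
  have hz : (d, v) ∈ K := ⟨⟨by simpa using hd, hv⟩, hw⟩
  have a₁ := le_abs_self M₁
  have a₂ := le_abs_self M₂
  have a₃ := le_abs_self M₃
  have a₄ := le_abs_self M₄
  have a₅ := le_abs_self M₅
  have a₆ := le_abs_self M₆
  have b₁ := abs_nonneg M₁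
  have b₂ := abs_nonneg M₂
  have b₃ := abs_nonneg M₃
  have b₄ := abs_nonneg M₄
  have b₅ := abs_nonneg M₅
  have b₆ := abs_nonneg M₆
  refine ⟨?_, ?_, (hM₁ _ hz).trans (by linarith), (hM₂ _ hz).trans (by linarith),
    (hM₃ _ hz).trans (by linarith), (hM₄ _ hz).trans (by linarith),
    (hM₅ _ hz).trans (by linarith), (hM₆ _ hz).trans (by linarith)⟩
  · exact contact_unit hA.ne' (hunit (d, v) hz)
  · exact (contDiffAt_unitMomentum_right (hunit (d, v) hz)).differentiableAt (by simp)

/-! ### The jet built from data on all dyadic lattices -/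

/-- One-jets of functions on `Vec n`: a base point, a momentum and a value. -/
abbrev Jet (n : ℕ) := Vec n × CoVec n × ℝ

/-- A lattice point as a vector. -/
def latticeVec (κ : Fin n → ℤ) : Vec n := fun i => (κ i : ℝ)

/-- Interpolation of values given on the whole lattice. -/
def lvl (g : (Fin n → ℤ) → E) (v : Vec n) : E := ∑ᶠ κ, node κ v • g κ

lemma abs_sub_lt_of_node_ne_zero {κ : Fin n → ℤ} {v : Vec n} (h : node κ v ≠ 0) (i : Fin n) :
    -7 / 10 < v i - κ i ∧ v i - κ i < 7 / 20 :=
  mem_of_bump_ne_zero fun h0 => h (Finset.prod_eq_zero (Finset.mem_univ i) h0)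

lemma off_injective : Function.Injective (off : (Fin n → Fin 5) → Fin n → ℤ) := by
  intro e e' h
  funext i
  have := congrFun h i
  simp only [off] at this
  exact Fin.ext (by omega)

lemma lvl_add (g : (Fin n → ℤ) → E) (κ₀ : Fin n → ℤ) {v : Vec n}
    (h : ∀ i, -1 ≤ v i ∧ v i ≤ 3) :
    lvl g (v + latticeVec κ₀) = win (fun e => g (κ₀ + off e)) v := by
  classical
  have hn : ∀ e : Fin n → Fin 5, node (κ₀ + off e) (v + latticeVec κ₀) = node (off e) v := by
    intro e
    refine Finset.prod_congr rfl fun i _ => ?_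
    congr 1
    simp [latticeVec, add_sub_add_left_eq_sub, add_comm (v i)]
  have hinj : Function.Injective fun e : Fin n → Fin 5 => κ₀ + off e :=
    (add_right_injective κ₀).comp off_injective
  unfold lvl win
  rw [finsum_eq_sum_of_support_subset (s := Finset.univ.image fun e => κ₀ + off e),
    Finset.sum_image hinj.injOn]
  · exact Finset.sum_congr rfl fun e _ => by rw [hn]
  · intro κ hκ
    have h0 : node κ (v + latticeVec κ₀) ≠ 0 := fun h0 => hκ (by simp [h0])
    have hb : ∀ i, 0 ≤ κ i - κ₀ i + 1 ∧ κ i - κ₀ i + 1 < 5 := by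
      intro i
      obtain ⟨h1, h2⟩ := abs_sub_lt_of_node_ne_zero h0 i
      obtain ⟨h3, h4⟩ := h i
      simp only [Pi.add_apply, latticeVec] at h1 h2
      have h5 : (-2 : ℝ) < ((κ i - κ₀ i : ℤ) : ℝ) := by push_cast; linarith
      have h6 : ((κ i - κ₀ i : ℤ) : ℝ) < 4 := by push_cast; linarith
      have h7 : (-2 : ℤ) < κ i - κ₀ i := by exact_mod_cast h5
      have h8 : κ i - κ₀ i < 4 := by exact_mod_cast h6
      omega
    simp only [Finset.coe_image, Finset.coe_univ, Set.image_univ, Set.mem_range]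
    refine ⟨fun i => ⟨(κ i - κ₀ i + 1).toNat, by have := hb i; omega⟩, ?_⟩
    funext i
    have := hb i
    simp only [Pi.add_apply, off]
    omega

lemma lvl_congr {g g' : (Fin n → ℤ) → E} {v : Vec n} (h : ∀ κ, node κ v ≠ 0 → g κ = g' κ) :
    lvl g v = lvl g' v := by
  refine finsum_congr fun κ => ?_
  by_cases h0 : node κ v = 0
  · simp [h0]
  · rw [h κ h0]

lemma exists_eq_add_latticeVec (v : Vec n) :
    ∃ κ : Fin n → ℤ, ∃ r ∈ Set.Icc (0 : Vec n) 1, v = r + latticeVec κ :=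
  ⟨fun i => ⌊v i⌋, fun i => Int.fract (v i),
    ⟨fun _ => Int.fract_nonneg _, fun _ => (Int.fract_lt_one _).le⟩,
    funext fun i => (Int.fract_add_floor (v i)).symm⟩

lemma win_const (a : E) {v : Vec n} (h : ∀ i, -1 ≤ v i ∧ v i ≤ 3) :
    win (fun _ => a) v = a := by
  rw [win, ← Finset.sum_smul, sum_node h, one_smul]

lemma lvl_const (a : E) (v : Vec n) : lvl (fun _ => a) v = a := by
  obtain ⟨κ, r, hr, rfl⟩ := exists_eq_add_latticeVec v
  have h : ∀ i, -1 ≤ r i ∧ r i ≤ 3 := fun i => by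
    have h1 := hr.1 i
    have h2 := hr.2 i
    simp only [Pi.zero_apply, Pi.one_apply] at h1 h2
    constructor <;> linarith
  rw [lvl_add _ _ h, win_const a h]

lemma twoScale_affine {F : Type*} [NormedAddCommGroup F] [NormedSpace ℝ F]
    (T : E →L[ℝ] F) (a : F) (w : (Fin n → Fin 5) → ℝ) (g₁ g₂ : (Fin n → Fin 5) → E)
    {v : Vec n} (h : ∀ i, -1 / 2 ≤ v i ∧ v i ≤ 3 / 2) :
    twoScale w (fun e => a + T (g₁ e)) (fun e => a + T (g₂ e)) v =
      a + T (twoScale w g₁ g₂ v) := by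
  have h1 : ∀ i, -1 ≤ v i ∧ v i ≤ 3 := fun i => ⟨by linarith [(h i).1], by linarith [(h i).2]⟩
  have h2 : ∀ i, -1 ≤ ((2 : ℝ) • v) i ∧ ((2 : ℝ) • v) i ≤ 3 := fun i => by
    simp only [Pi.smul_apply, smul_eq_mul]
    exact ⟨by linarith [(h i).1], by linarith [(h i).2]⟩
  have e1 : win (fun e => a + T (g₂ e)) ((2 : ℝ) • v) = a + T (win g₂ ((2 : ℝ) • v)) := by
    have := win_const a h2
    unfold win at this ⊢
    simp only [smul_add, Finset.sum_add_distrib, this, map_sum, map_smul]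
  have e2 : win (fun e => (1 - w e) • (a + T (g₁ e))) v =
      a - win w v • a + T (win (fun e => (1 - w e) • g₁ e) v) := by
    have h3 := win_const a h1
    have h4 : win w v • a = ∑ e, node (off e) v • w e • a := by
      simp only [win, Finset.sum_smul, smul_assoc]
    rw [h4]
    unfold win at h3 ⊢
    simp only [smul_add, sub_smul, one_smul, smul_sub, Finset.sum_add_distrib,
      Finset.sum_sub_distrib, h3, map_sub, map_sum, map_smul]
  unfold twoScale
  rw [e1, e2, map_add, map_smul, smul_add]
  abel

/-- Weights and jets at all nodes of all dyadic lattices. -/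
structure GridData (n : ℕ) where
  /-- The weight at a node; it selects the next finer level. -/
  weight : ℤ → (Fin n → ℤ) → ℝ
  /-- The jet at a node. -/
  jet : ℤ → (Fin n → ℤ) → Jet n

namespace GridData

variable (G : GridData n) (A : ℝ) (j : ℤ)

/-- The blending parameter between the levels `j` and `j + 1`. -/
def blend (u : Vec n) : ℝ := lvl (G.weight j) ((2 : ℝ) ^ j • u)

/-- Interpolation of nodal values between the levels `j` and `j + 1`. -/
def field (g : ℤ → (Fin n → ℤ) → E) (u : Vec n) : E :=
  lvl (fun κ => (1 - G.weight j κ) • g j κ) ((2 : ℝ) ^ j • u) +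
    G.blend j u • lvl (g (j + 1)) ((2 : ℝ) ^ (j + 1) • u)

/-- The base map at level `j`. -/
def base (u : Vec n) : Vec n :=
  G.field j (fun i κ => (G.jet i κ).1) u +
    (A * ((2 : ℝ) ^ j)⁻¹) • displacement (G.blend j u) ((2 : ℝ) ^ j • u)

/-- The interpolated momenta at level `j`. -/
def mean (u : Vec n) : CoVec n := G.field j (fun i κ => (G.jet i κ).2.1) u

/-- The interpolated constant terms at level `j`. -/
def const (u : Vec n) : ℝ :=
  G.field j (fun i κ => (G.jet i κ).2.2 - (G.jet i κ).2.1 (G.jet i κ).1) u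

/-- The slope of the staircase at level `j`. -/
def slopeAt (u : Vec n) : Vec n →L[ℝ] Vec n := slope (G.blend j u) ((2 : ℝ) ^ j • u)

/-- The jet at level `j`. -/
def levelJet (u : Vec n) : Jet n :=
  (G.base A j u, momentum A (G.base A j) (G.const j) (G.mean j) (G.slopeAt j) u,
    G.const j u + G.mean j u (G.base A j u))

/-- The nodal data around `κ`, rescaled to unit scale and relative to the jet `q`. -/
def normalize (κ : Fin n → ℤ) (q : Jet n) : NodeData n :=
  (fun e => G.weight j (κ + off e),
    (fun e => (2 : ℝ) ^ j • ((G.jet j (κ + off e)).1 - q.1),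
      fun e => (2 : ℝ) ^ j • ((G.jet (j + 1) (κ + κ + off e)).1 - q.1)),
    (fun e => (2 : ℝ) ^ j • ((G.jet j (κ + off e)).2.1 - q.2.1),
      fun e => (2 : ℝ) ^ j • ((G.jet (j + 1) (κ + κ + off e)).2.1 - q.2.1)),
    (fun e => ((2 : ℝ) ^ j) ^ 2 * ((G.jet j (κ + off e)).2.2 - q.2.2 -
        (G.jet j (κ + off e)).2.1 ((G.jet j (κ + off e)).1 - q.1)),
      fun e => ((2 : ℝ) ^ j) ^ 2 * ((G.jet (j + 1) (κ + κ + off e)).2.2 - q.2.2 -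
        (G.jet (j + 1) (κ + κ + off e)).2.1 ((G.jet (j + 1) (κ + κ + off e)).1 - q.1))))

variable {G A j} {κ : Fin n → ℤ} {q : Jet n} {u v : Vec n}

lemma blend_eq (hu : (2 : ℝ) ^ j • u = v + latticeVec κ)
    (h : ∀ i, -1 / 2 ≤ v i ∧ v i ≤ 3 / 2) :
    G.blend j u = win (fun e => G.weight j (κ + off e)) v := by
  rw [blend, hu, lvl_add _ _ fun i => ⟨by linarith [(h i).1], by linarith [(h i).2]⟩]

lemma field_eq (g : ℤ → (Fin n → ℤ) → E) (hu : (2 : ℝ) ^ j • u = v + latticeVec κ)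
    (h : ∀ i, -1 / 2 ≤ v i ∧ v i ≤ 3 / 2) :
    G.field j g u = twoScale (fun e => G.weight j (κ + off e)) (fun e => g j (κ + off e))
      (fun e => g (j + 1) (κ + κ + off e)) v := by
  have h1 : (2 : ℝ) ^ (j + 1) • u = (2 : ℝ) • v + latticeVec (κ + κ) := by
    rw [zpow_add_one₀ two_ne_zero, mul_comm, mul_smul, hu, smul_add]
    congr 1
    ext i
    simp [latticeVec, two_mul]
  rw [field, blend_eq hu h, hu, h1, lvl_add, lvl_add]
  · rfl
  · intro i
    simp only [Pi.smul_apply, smul_eq_mul]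
    exact ⟨by linarith [(h i).1], by linarith [(h i).2]⟩
  · exact fun i => ⟨by linarith [(h i).1], by linarith [(h i).2]⟩

lemma displacement_add (b : ℝ) (v : Vec n) (κ : Fin n → ℤ) :
    displacement b (v + latticeVec κ) = displacement b v := by
  ext i
  have h1 := stair_add_int (v i) (κ i)
  have h2 := stair_add_int (2 * v i) (κ i + κ i)
  have h3 : 2 * (v i + κ i) = 2 * v i + ((κ i + κ i : ℤ) : ℝ) := by push_cast; ring
  simp only [displacement, latticeVec, Pi.add_apply]
  rw [h1, h3, h2]
  push_cast
  ring

lemma slope_add (b : ℝ) (v : Vec n) (κ : Fin n → ℤ) :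
    slope b (v + latticeVec κ) = slope b v := by
  ext1 x
  rw [slope_apply, slope_apply]
  ext i
  have h1 := deriv_stair_add_int (v i) (κ i)
  have h2 := deriv_stair_add_int (2 * v i) (κ i + κ i)
  have h3 : 2 * (v i + κ i) = 2 * v i + ((κ i + κ i : ℤ) : ℝ) := by push_cast; ring
  simp only [latticeVec, Pi.add_apply]
  rw [h1, h3, h2]

lemma slopeAt_eq (hu : (2 : ℝ) ^ j • u = v + latticeVec κ)
    (h : ∀ i, -1 / 2 ≤ v i ∧ v i ≤ 3 / 2) :
    G.slopeAt j u = slope (win (G.normalize j κ q).1 v) v := by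
  rw [slopeAt, blend_eq hu h, hu, slope_add]
  rfl

lemma base_eq (hu : (2 : ℝ) ^ j • u = v + latticeVec κ)
    (h : ∀ i, -1 / 2 ≤ v i ∧ v i ≤ 3 / 2) :
    G.base A j u = q.1 + ((2 : ℝ) ^ j)⁻¹ • unitBase A (G.normalize j κ q) v := by
  have hs : (2 : ℝ) ^ j ≠ 0 := by positivity
  rw [base, field_eq _ hu h, blend_eq hu h, hu, displacement_add]
  have h1 := twoScale_affine (((2 : ℝ) ^ j)⁻¹ • ContinuousLinearMap.id ℝ (Vec n)) q.1
    (G.normalize j κ q).1 (G.normalize j κ q).2.1.1 (G.normalize j κ q).2.1.2 h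
  simp only [normalize, _root_.smul_apply, ContinuousLinearMap.id_apply, smul_smul,
    inv_mul_cancel₀ hs, one_smul, add_sub_cancel] at h1
  rw [h1, unitBase, smul_add, smul_smul, mul_comm A, ← add_assoc]
  simp only [normalize]

lemma mean_eq (hu : (2 : ℝ) ^ j • u = v + latticeVec κ)
    (h : ∀ i, -1 / 2 ≤ v i ∧ v i ≤ 3 / 2) :
    G.mean j u = q.2.1 + ((2 : ℝ) ^ j)⁻¹ • unitMean (G.normalize j κ q) v := by
  have hs : (2 : ℝ) ^ j ≠ 0 := by positivity
  rw [mean, field_eq _ hu h]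
  have h1 := twoScale_affine (((2 : ℝ) ^ j)⁻¹ • ContinuousLinearMap.id ℝ (CoVec n)) q.2.1
    (G.normalize j κ q).1 (G.normalize j κ q).2.2.1.1 (G.normalize j κ q).2.2.1.2 h
  simp only [normalize, _root_.smul_apply, ContinuousLinearMap.id_apply, smul_smul,
    inv_mul_cancel₀ hs, one_smul, add_sub_cancel] at h1
  rw [h1, unitMean]
  simp only [normalize]

lemma const_eq (hu : (2 : ℝ) ^ j • u = v + latticeVec κ)
    (h : ∀ i, -1 / 2 ≤ v i ∧ v i ≤ 3 / 2) :
    G.const j u = q.2.2 - q.2.1 q.1 + (((2 : ℝ) ^ j)⁻¹ ^ 2 * unitConst (G.normalize j κ q) v -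
      ((2 : ℝ) ^ j)⁻¹ * unitMean (G.normalize j κ q) v q.1) := by
  have hs : (2 : ℝ) ^ j ≠ 0 := by positivity
  set d := G.normalize j κ q with hd
  have h0 : ∀ (g₁ g₂ : (Fin n → Fin 5) → CoVec n × ℝ),
      twoScale d.1 g₁ g₂ v = (twoScale d.1 (fun e => (g₁ e).1) (fun e => (g₂ e).1) v,
        twoScale d.1 (fun e => (g₁ e).2) (fun e => (g₂ e).2) v) := by
    intro g₁ g₂
    have e1 := twoScale_affine (ContinuousLinearMap.fst ℝ (CoVec n) ℝ) 0 d.1 g₁ g₂ h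
    have e2 := twoScale_affine (ContinuousLinearMap.snd ℝ (CoVec n) ℝ) 0 d.1 g₁ g₂ h
    simp only [zero_add, ContinuousLinearMap.coe_fst', ContinuousLinearMap.coe_snd'] at e1 e2
    rw [e1, e2]
  let T : CoVec n × ℝ →L[ℝ] ℝ := ((2 : ℝ) ^ j)⁻¹ ^ 2 • ContinuousLinearMap.snd ℝ (CoVec n) ℝ -
    ((2 : ℝ) ^ j)⁻¹ • (ContinuousLinearMap.apply ℝ ℝ q.1 ∘L ContinuousLinearMap.fst ℝ (CoVec n) ℝ)
  have hT : ∀ x, T x = ((2 : ℝ) ^ j)⁻¹ ^ 2 * x.2 - ((2 : ℝ) ^ j)⁻¹ * x.1 q.1 := fun x => by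
    simp [T]
  have h1 := twoScale_affine T (q.2.2 - q.2.1 q.1) d.1
    (fun e => (d.2.2.1.1 e, d.2.2.2.1 e)) (fun e => (d.2.2.1.2 e, d.2.2.2.2 e)) h
  rw [h0, hT] at h1
  rw [const, field_eq _ hu h]
  refine Eq.trans ?_ h1
  have key : ∀ r : Jet n, r.2.2 - r.2.1 r.1 = q.2.2 - q.2.1 q.1 +
      (((2 : ℝ) ^ j)⁻¹ ^ 2 * (((2 : ℝ) ^ j) ^ 2 * (r.2.2 - q.2.2 - r.2.1 (r.1 - q.1))) -
        ((2 : ℝ) ^ j)⁻¹ * ((2 : ℝ) ^ j • (r.2.1 - q.2.1)) q.1) := by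
    intro r
    simp only [_root_.smul_apply, _root_.sub_apply, map_sub, smul_eq_mul]
    field_simp
    ring
  simp only [hT, hd, normalize]
  congr 1
  · funext e; exact key _
  · funext e; exact key _

end GridData

/-! ### Rescaling -/

lemma differentiable_unitBase (A : ℝ) (d : NodeData n) : Differentiable ℝ (unitBase A d) :=
  ((contDiff_twoScale _ _ _).add ((contDiff_const_smul A).comp
    (contDiff_displacement_param (contDiff_win _) contDiff_id))).differentiable (by simp)

lemma differentiable_unitMean (d : NodeData n) : Differentiable ℝ (unitMean d) :=
  (contDiff_twoScale _ _ _).differentiable (by simp)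

lemma differentiable_unitConst (d : NodeData n) : Differentiable ℝ (unitConst d) :=
  (contDiff_twoScale _ _ _).differentiable (by simp)

lemma hasFDerivAt_comp_scale {g : Vec n → E} {D : Vec n →L[ℝ] E} {s : ℝ} {l u : Vec n}
    (h : HasFDerivAt g D (s • u - l)) :
    HasFDerivAt (fun y => g (s • y - l)) (s • D) u := by
  have h1 : HasFDerivAt (fun y : Vec n => s • y - l) (s • ContinuousLinearMap.id ℝ (Vec n)) u :=
    (s • ContinuousLinearMap.id ℝ (Vec n)).hasFDerivAt.sub_const l
  refine (HasFDerivAt.comp u h h1).congr_fderiv ?_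
  ext1 x
  simp

/-- The unit-scale jet, shrunk by the factor `t` and translated by the jet `q`. -/
def unitJet (A : ℝ) (d : NodeData n) (t : ℝ) (q : Jet n) (v : Vec n) : Jet n :=
  (q.1 + t • unitBase A d v, q.2.1 + t • unitMomentum A d v,
    q.2.2 + t * q.2.1 (unitBase A d v) +
      t ^ 2 * (unitConst d v + unitMean d v (unitBase A d v)))

/-- The behaviour of `momentum` under the affine changes of scale. -/
lemma momentum_rescale {A s : ℝ} {X X₁ : Vec n → Vec n} {C C₁ : Vec n → ℝ}
    {p p₁ : Vec n → CoVec n} {R R₁ : Vec n → Vec n →L[ℝ] Vec n} {x₀ l u : Vec n} {c₀ : ℝ}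
    {p₀ : CoVec n} (hs : s ≠ 0)
    (hX : X =ᶠ[𝓝 u] fun y => x₀ + s⁻¹ • X₁ (s • y - l))
    (hp : p =ᶠ[𝓝 u] fun y => p₀ + s⁻¹ • p₁ (s • y - l))
    (hC : C =ᶠ[𝓝 u] fun y => c₀ + (s⁻¹ ^ 2 * C₁ (s • y - l) - s⁻¹ * p₁ (s • y - l) x₀))
    (hR : R u = R₁ (s • u - l)) (dX : DifferentiableAt ℝ X₁ (s • u - l))
    (dp : DifferentiableAt ℝ p₁ (s • u - l)) (dC : DifferentiableAt ℝ C₁ (s • u - l)) :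
    HasFDerivAt X (fderiv ℝ X₁ (s • u - l)) u ∧
      momentum A X C p R u = p₀ + s⁻¹ • momentum A X₁ C₁ p₁ R₁ (s • u - l) := by
  have h1 : HasFDerivAt X (fderiv ℝ X₁ (s • u - l)) u := by
    refine HasFDerivAt.congr_of_eventuallyEq ?_ hX
    refine (((hasFDerivAt_comp_scale dX.hasFDerivAt).const_smul s⁻¹).const_add x₀).congr_fderiv ?_
    rw [smul_smul, inv_mul_cancel₀ hs, one_smul]
  have h2 : HasFDerivAt p (fderiv ℝ p₁ (s • u - l)) u := by
    refine HasFDerivAt.congr_of_eventuallyEq ?_ hp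
    refine (((hasFDerivAt_comp_scale dp.hasFDerivAt).const_smul s⁻¹).const_add p₀).congr_fderiv ?_
    rw [smul_smul, inv_mul_cancel₀ hs, one_smul]
  have h3 : HasFDerivAt C (s⁻¹ • fderiv ℝ C₁ (s • u - l) -
      (fderiv ℝ p₁ (s • u - l)).flip x₀) u := by
    refine HasFDerivAt.congr_of_eventuallyEq ?_ hC
    have e1 := (hasFDerivAt_comp_scale dC.hasFDerivAt).const_mul (s⁻¹ ^ 2)
    have e2 := ((hasFDerivAt_comp_scale dp.hasFDerivAt).clm_apply
      (hasFDerivAt_const x₀ u)).const_mul s⁻¹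
    refine ((e1.sub e2).const_add c₀).congr_fderiv ?_
    ext1 x
    simp
    field_simp
  refine ⟨h1, ?_⟩
  have hXu := hX.self_of_nhds
  have hpu := hp.self_of_nhds
  simp only at hXu hpu
  unfold momentum
  rw [h1.fderiv, h2.fderiv, h3.fderiv, hR, hXu, hpu, smul_add, add_assoc]
  congr 2
  rw [← ContinuousLinearMap.smul_comp]
  congr 1
  ext1 x
  simp
  ring

/-- A jet-valued map whose components are Lipschitz to first order, with the contact
condition. -/
def IsContactAt (M : ℝ) (F : Vec n → Jet n) (u : Vec n) : Prop :=
  ∃ D : Vec n →L[ℝ] Vec n, ∃ D' : Vec n →L[ℝ] CoVec n, ‖D‖ ≤ M ∧ ‖D'‖ ≤ M ∧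
    HasFDerivAt (fun y => (F y).1) D u ∧ HasFDerivAt (fun y => (F y).2.1) D' u ∧
      HasFDerivAt (fun y => (F y).2.2) ((F u).2.1 ∘L D) u

lemma IsContactAt.congr {M : ℝ} {F F' : Vec n → Jet n} {u : Vec n} (h : IsContactAt M F u)
    (hF : F' =ᶠ[𝓝 u] F) : IsContactAt M F' u := by
  obtain ⟨D, D', h1, h2, h3, h4, h5⟩ := h
  refine ⟨D, D', h1, h2, h3.congr_of_eventuallyEq (hF.fun_comp fun q => q.1),
    h4.congr_of_eventuallyEq (hF.fun_comp fun q => q.2.1), ?_⟩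
  rw [hF.self_of_nhds]
  exact h5.congr_of_eventuallyEq (hF.fun_comp fun q => q.2.2)

/-- Two jets that are compatible at distance `r`. -/
structure Near (r : ℝ) (q q' : Jet n) : Prop where
  base : ‖q.1 - q'.1‖ ≤ r
  momentum : ‖q.2.1 - q'.2.1‖ ≤ r
  value : |q.2.2 - q'.2.2 - q'.2.1 (q.1 - q'.1)| ≤ r ^ 2

namespace Near

variable {q q' q'' : Jet n} {r s : ℝ}

lemma nonneg (h : Near r q q') : 0 ≤ r := (norm_nonneg _).trans h.base

lemma mono (h : Near r q q') (hrs : r ≤ s) : Near s q q' :=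
  ⟨h.base.trans hrs, h.momentum.trans hrs, h.value.trans (by have := h.nonneg; gcongr)⟩

lemma refl : Near 0 q q := ⟨by simp, by simp, by simp⟩

lemma trans (h : Near r q q') (h' : Near s q' q'') : Near (r + s) q q'' := by
  refine ⟨?_, ?_, ?_⟩
  · calc ‖q.1 - q''.1‖ = ‖(q.1 - q'.1) + (q'.1 - q''.1)‖ := by congr 1; abel
      _ ≤ _ := (norm_add_le _ _).trans (add_le_add h.base h'.base)
  · calc ‖q.2.1 - q''.2.1‖ = ‖(q.2.1 - q'.2.1) + (q'.2.1 - q''.2.1)‖ := by congr 1; abel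
      _ ≤ _ := (norm_add_le _ _).trans (add_le_add h.momentum h'.momentum)
  · have e : q.2.2 - q''.2.2 - q''.2.1 (q.1 - q''.1) =
        (q.2.2 - q'.2.2 - q'.2.1 (q.1 - q'.1)) + (q'.2.2 - q''.2.2 - q''.2.1 (q'.1 - q''.1)) +
          (q'.2.1 - q''.2.1) (q.1 - q'.1) := by
      simp only [_root_.sub_apply, map_sub]; ring
    have h1 : |(q'.2.1 - q''.2.1) (q.1 - q'.1)| ≤ s * r :=
      ((q'.2.1 - q''.2.1).le_opNorm _).trans
        (mul_le_mul h'.momentum h.base (norm_nonneg _) h'.nonneg)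
    rw [e]
    have hr := h.nonneg
    have hs := h'.nonneg
    calc _ ≤ r ^ 2 + s ^ 2 + s * r := (abs_add_le _ _).trans
          (add_le_add ((abs_add_le _ _).trans (add_le_add h.value h'.value)) h1)
      _ ≤ (r + s) ^ 2 := by nlinarith [mul_nonneg hr hs]

lemma symm (h : Near r q q') : Near (2 * r) q' q := by
  have hr := h.nonneg
  refine ⟨?_, ?_, ?_⟩
  · rw [norm_sub_rev]; linarith [h.base]
  · rw [norm_sub_rev]; linarith [h.momentum]
  · have e : q'.2.2 - q.2.2 - q.2.1 (q'.1 - q.1) =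
        -(q.2.2 - q'.2.2 - q'.2.1 (q.1 - q'.1)) + (q.2.1 - q'.2.1) (q.1 - q'.1) := by
      simp only [_root_.sub_apply, map_sub]; ring
    have h1 : |(q.2.1 - q'.2.1) (q.1 - q'.1)| ≤ r * r :=
      ((q.2.1 - q'.2.1).le_opNorm _).trans
        (mul_le_mul h.momentum h.base (norm_nonneg _) hr)
    rw [e]
    calc _ ≤ r ^ 2 + r * r := (abs_add_le _ _).trans
          (add_le_add (by rw [abs_neg]; exact h.value) h1)
      _ ≤ (2 * r) ^ 2 := by nlinarith [mul_nonneg hr hr]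

end Near

namespace GridData

variable {G : GridData n} {A M : ℝ} {j : ℤ} {κ : Fin n → ℤ} {q : Jet n} {u v : Vec n}

/-- The level-`j` jet in terms of the rescaled jet at unit scale. -/
lemma levelJet_eventuallyEq (A : ℝ) (q : Jet n) (hu : (2 : ℝ) ^ j • u = v + latticeVec κ)
    (h : v ∈ Set.Icc (0 : Vec n) 1) :
    G.levelJet A j =ᶠ[𝓝 u] fun y =>
      unitJet A (G.normalize j κ q) ((2 : ℝ) ^ j)⁻¹ q ((2 : ℝ) ^ j • y - latticeVec κ) := by
  have hs : (2 : ℝ) ^ j ≠ 0 := by positivity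
  set d := G.normalize j κ q with hd
  have hnear : ∀ᶠ y in 𝓝 u, ∀ i, -1 / 2 ≤ ((2 : ℝ) ^ j • y - latticeVec κ) i ∧
      ((2 : ℝ) ^ j • y - latticeVec κ) i ≤ 3 / 2 := by
    rw [eventually_all]
    intro i
    have hc : ContinuousAt (fun y : Vec n => ((2 : ℝ) ^ j • y - latticeVec κ) i) u := by fun_prop
    have hv : ((2 : ℝ) ^ j • u - latticeVec κ) i = v i := by rw [hu]; simp
    have h0 := h.1 i
    have h1 := h.2 i
    simp only [Pi.zero_apply, Pi.one_apply] at h0 h1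
    refine (hc.eventually (Ioo_mem_nhds (a := -1 / 2) (b := 3 / 2) ?_ ?_)).mono
      fun y hy => ⟨hy.1.le, hy.2.le⟩
    · change -1 / 2 < ((2 : ℝ) ^ j • u - latticeVec κ) i
      rw [hv]; linarith
    · change ((2 : ℝ) ^ j • u - latticeVec κ) i < 3 / 2
      rw [hv]; linarith
  have hdec : ∀ y : Vec n, (2 : ℝ) ^ j • y = ((2 : ℝ) ^ j • y - latticeVec κ) + latticeVec κ :=
    fun y => (sub_add_cancel _ _).symm
  filter_upwards [hnear.eventually_nhds] with y hy
  have hy0 := hy.self_of_nhds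
  have hm := (momentum_rescale (A := A) (X := G.base A j) (X₁ := unitBase A d)
    (p := G.mean j) (p₁ := unitMean d) (C := G.const j) (C₁ := unitConst d)
    (R := G.slopeAt j) (R₁ := fun v => slope (win d.1 v) v) hs
    (hy.mono fun z hz => base_eq (A := A) (q := q) (hdec z) hz)
    (hy.mono fun z hz => mean_eq (q := q) (hdec z) hz)
    (hy.mono fun z hz => const_eq (q := q) (hdec z) hz)
    (slopeAt_eq (q := q) (hdec y) hy0)
    (differentiable_unitBase A d _) (differentiable_unitMean d _) (differentiable_unitConst d _)).2
  refine Prod.ext (base_eq (hdec y) hy0) (Prod.ext hm ?_)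
  simp only [levelJet]
  rw [const_eq (q := q) (hdec y) hy0, mean_eq (q := q) (hdec y) hy0,
    base_eq (q := q) (hdec y) hy0]
  simp only [unitJet, hd, _root_.add_apply, _root_.smul_apply, map_add, map_smul, smul_eq_mul]
  ring

/-- First-order control of the level-`j` jet. -/
lemma levelJet_isContactAt (hu : (2 : ℝ) ^ j • u = v + latticeVec κ)
    (h : v ∈ Set.Icc (0 : Vec n) 1) (hb : UnitBounds A M (G.normalize j κ q) v) :
    IsContactAt M (G.levelJet A j) u := by
  have hs : (2 : ℝ) ^ j ≠ 0 := by positivity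
  refine IsContactAt.congr ?_ (levelJet_eventuallyEq A q hu h)
  set d := G.normalize j κ q with hd
  set s := (2 : ℝ) ^ j with hsdef
  have hv : s • u - latticeVec κ = v := by rw [hu, add_sub_cancel_right]
  have dX : HasFDerivAt (unitBase A d) (fderiv ℝ (unitBase A d) v) v :=
    (differentiable_unitBase A d v).hasFDerivAt
  have dp : HasFDerivAt (unitMean d) (fderiv ℝ (unitMean d) v) v :=
    (differentiable_unitMean d v).hasFDerivAt
  have dC : HasFDerivAt (unitConst d) (fderiv ℝ (unitConst d) v) v :=
    (differentiable_unitConst d v).hasFDerivAt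
  have dP := hb.differentiable.hasFDerivAt
  have dW := dC.add (dp.clm_apply dX)
  have dY := q.2.1.hasFDerivAt.comp v dX
  rw [← hv] at dX dP dW dY
  have eX := ((hasFDerivAt_comp_scale dX).const_smul s⁻¹).const_add q.1
  have eP := ((hasFDerivAt_comp_scale dP).const_smul s⁻¹).const_add q.2.1
  have eZ := (((hasFDerivAt_comp_scale dY).const_mul s⁻¹).const_add q.2.2).add
    ((hasFDerivAt_comp_scale dW).const_mul (s⁻¹ ^ 2))
  rw [smul_smul, inv_mul_cancel₀ hs, one_smul, hv] at eX eP
  refine ⟨_, _, hb.fderiv_base_le, hb.fderiv_momentum_le, eX, eP, eZ.congr_fderiv ?_⟩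
  have hc := hb.contact
  rw [hv]
  ext1 x
  have hcx := congrArg (fun T : CoVec n => T x) hc
  simp only [_root_.add_apply, ContinuousLinearMap.comp_apply,
    ContinuousLinearMap.flip_apply] at hcx
  simp only [unitJet, hv, _root_.add_apply, _root_.smul_apply, ContinuousLinearMap.comp_apply,
    ContinuousLinearMap.flip_apply, smul_eq_mul, ← hcx]
  field_simp
  ring

/-- The level-`j` jet is close to the reference jet. -/
lemma near_levelJet (hu : (2 : ℝ) ^ j • u = v + latticeVec κ)
    (h : v ∈ Set.Icc (0 : Vec n) 1) (hM : 0 ≤ M) (hb : UnitBounds A M (G.normalize j κ q) v) :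
    Near (((2 : ℝ) ^ j)⁻¹ * (M + 1)) (G.levelJet A j u) q := by
  have hs : 0 ≤ ((2 : ℝ) ^ j)⁻¹ := by positivity
  have he := (levelJet_eventuallyEq (G := G) A q hu h).self_of_nhds
  simp only at he
  rw [he, hu, add_sub_cancel_right]
  set d := G.normalize j κ q with hd
  set t := ((2 : ℝ) ^ j)⁻¹
  refine ⟨?_, ?_, ?_⟩
  · simp only [unitJet, add_sub_cancel_left, norm_smul, Real.norm_of_nonneg hs]
    exact mul_le_mul_of_nonneg_left (hb.base_le.trans (by linarith)) hs
  · simp only [unitJet, add_sub_cancel_left, norm_smul, Real.norm_of_nonneg hs]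
    exact mul_le_mul_of_nonneg_left (hb.momentum_le.trans (by linarith)) hs
  · have e : (unitJet A d t q v).2.2 - q.2.2 - q.2.1 ((unitJet A d t q v).1 - q.1) =
        t ^ 2 * (unitConst d v + unitMean d v (unitBase A d v)) := by
      simp only [unitJet, add_sub_cancel_left, map_smul, smul_eq_mul]
      ring
    have h1 : |unitMean d v (unitBase A d v)| ≤ M * M :=
      ((unitMean d v).le_opNorm _).trans
        (mul_le_mul hb.mean_le hb.base_le (norm_nonneg _) hM)
    rw [e, abs_mul, abs_of_nonneg (by positivity), mul_pow]
    refine mul_le_mul_of_nonneg_left ?_ (by positivity)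
    refine (abs_add_le _ _).trans ((add_le_add hb.const_le h1).trans ?_)
    nlinarith

end GridData

/-! ### The extension from a closed subset of `ℝⁿ` -/

namespace GridData

variable {G : GridData n} {A : ℝ} {j : ℤ} {u : Vec n}

lemma blend_succ_eq (h : (∀ κ, node κ ((2 : ℝ) ^ j • u) ≠ 0 → G.weight j κ = 1) ∧
    ∀ κ, node κ ((2 : ℝ) ^ (j + 1) • u) ≠ 0 → G.weight (j + 1) κ = 0) :
    G.blend j u = 1 ∧ G.blend (j + 1) u = 0 := by
  constructor
  · rw [blend, lvl_congr (g' := fun _ => (1 : ℝ)) h.1, lvl_const]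
  · rw [blend, lvl_congr (g' := fun _ => (0 : ℝ)) h.2, lvl_const]

lemma field_succ_eq (h : (∀ κ, node κ ((2 : ℝ) ^ j • u) ≠ 0 → G.weight j κ = 1) ∧
    ∀ κ, node κ ((2 : ℝ) ^ (j + 1) • u) ≠ 0 → G.weight (j + 1) κ = 0)
    (g : ℤ → (Fin n → ℤ) → E) : G.field (j + 1) g u = G.field j g u := by
  obtain ⟨h1, h2⟩ := blend_succ_eq h
  rw [field, field, h1, h2,
    lvl_congr (g := fun κ => (1 - G.weight (j + 1) κ) • g (j + 1) κ) (g' := fun κ => g (j + 1) κ),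
    lvl_congr (g := fun κ => (1 - G.weight j κ) • g j κ) (g' := fun _ => 0), lvl_const]
  · simp only [zero_smul, one_smul, add_zero, zero_add]
  · intro κ hκ; simp only [h.1 κ hκ, sub_self, zero_smul]
  · intro κ hκ; simp only [h.2 κ hκ, sub_zero, one_smul]

lemma base_succ_eq (h : (∀ κ, node κ ((2 : ℝ) ^ j • u) ≠ 0 → G.weight j κ = 1) ∧
    ∀ κ, node κ ((2 : ℝ) ^ (j + 1) • u) ≠ 0 → G.weight (j + 1) κ = 0) :
    G.base A (j + 1) u = G.base A j u := by
  obtain ⟨h1, h2⟩ := blend_succ_eq h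
  have hs : (2 : ℝ) ^ (j + 1) • u = (2 : ℝ) • (2 : ℝ) ^ j • u := by
    rw [zpow_add_one₀ two_ne_zero, mul_comm, mul_smul]
  rw [base, base, field_succ_eq h, h1, h2, hs]
  congr 1
  ext i
  simp only [displacement, Pi.smul_apply, smul_eq_mul]
  rw [zpow_add_one₀ two_ne_zero]
  have : (2 : ℝ) ^ j ≠ 0 := by positivity
  field_simp
  ring

lemma slopeAt_succ_eq (h : (∀ κ, node κ ((2 : ℝ) ^ j • u) ≠ 0 → G.weight j κ = 1) ∧
    ∀ κ, node κ ((2 : ℝ) ^ (j + 1) • u) ≠ 0 → G.weight (j + 1) κ = 0) :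
    G.slopeAt (j + 1) u = G.slopeAt j u := by
  obtain ⟨h1, h2⟩ := blend_succ_eq h
  have hs : (2 : ℝ) ^ (j + 1) • u = (2 : ℝ) • (2 : ℝ) ^ j • u := by
    rw [zpow_add_one₀ two_ne_zero, mul_comm, mul_smul]
  rw [slopeAt, slopeAt, h1, h2, hs]
  ext1 x
  rw [slope_apply, slope_apply]
  simp

/-- Consecutive levels agree where the weights are locally constant. -/
lemma levelJet_succ_eq (h : ∀ᶠ y in 𝓝 u, (∀ κ, node κ ((2 : ℝ) ^ j • y) ≠ 0 → G.weight j κ = 1) ∧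
    ∀ κ, node κ ((2 : ℝ) ^ (j + 1) • y) ≠ 0 → G.weight (j + 1) κ = 0) :
    G.levelJet A (j + 1) u = G.levelJet A j u := by
  have hX : G.base A (j + 1) =ᶠ[𝓝 u] G.base A j := h.mono fun y hy => base_succ_eq hy
  have hC : G.const (j + 1) =ᶠ[𝓝 u] G.const j := h.mono fun y hy => field_succ_eq hy _
  have hp : G.mean (j + 1) =ᶠ[𝓝 u] G.mean j := h.mono fun y hy => field_succ_eq hy _
  have hm : momentum A (G.base A (j + 1)) (G.const (j + 1)) (G.mean (j + 1)) (G.slopeAt (j + 1)) u =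
      momentum A (G.base A j) (G.const j) (G.mean j) (G.slopeAt j) u := by
    rw [momentum, momentum, hX.fderiv_eq, hC.fderiv_eq, hp.fderiv_eq, hX.self_of_nhds,
      hp.self_of_nhds, slopeAt_succ_eq h.self_of_nhds]
  rw [levelJet, levelJet, hm, hX.self_of_nhds, hC.self_of_nhds, hp.self_of_nhds]

end GridData

/-- A nearest point of `S`. -/
def nearest (S : Set (Vec n)) (u : Vec n) : Vec n :=
  Classical.epsilon fun a => a ∈ S ∧ infDist u S = dist u a

lemma nearest_spec {S : Set (Vec n)} (hS : IsClosed S) (hne : S.Nonempty) (u : Vec n) :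
    nearest S u ∈ S ∧ infDist u S = dist u (nearest S u) :=
  Classical.epsilon_spec (p := fun a => a ∈ S ∧ infDist u S = dist u a)
    (hS.exists_infDist_eq_dist hne u)

/-- The weights and jets attached to the dyadic nodes by a jet-valued function `f` on `S`. -/
def whitneyData (K : ℝ) (S : Set (Vec n)) (f : Vec n → Jet n) : GridData n where
  weight j κ := max 0 (min 1 (2 * (7 / 4 -
    (2 : ℝ) ^ j * infDist (((2 : ℝ) ^ j)⁻¹ • latticeVec κ) S / K)))
  jet j κ := f (nearest S (((2 : ℝ) ^ j)⁻¹ • latticeVec κ))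

/-- The level at which the extension is evaluated. -/
def level (K : ℝ) (S : Set (Vec n)) (u : Vec n) : ℤ :=
  Classical.epsilon fun j : ℤ =>
    K ≤ (2 : ℝ) ^ j * infDist u S ∧ (2 : ℝ) ^ j * infDist u S < 2 * K

open Classical in
/-- The extension of `f` from `S`. -/
def extension (A K : ℝ) (S : Set (Vec n)) (f : Vec n → Jet n) (u : Vec n) : Jet n :=
  if u ∈ S then f u else (whitneyData K S f).levelJet A (level K S u) u

section Extension

variable {A K : ℝ} {S : Set (Vec n)} {f : Vec n → Jet n} {u : Vec n} {j : ℤ}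

lemma level_spec (hK : 0 < K) (hu : 0 < infDist u S) :
    K ≤ (2 : ℝ) ^ level K S u * infDist u S ∧
      (2 : ℝ) ^ level K S u * infDist u S < 2 * K := by
  refine Classical.epsilon_spec (p := fun j : ℤ =>
    K ≤ (2 : ℝ) ^ j * infDist u S ∧ (2 : ℝ) ^ j * infDist u S < 2 * K) ?_
  obtain ⟨m, h1, h2⟩ := exists_mem_Ioc_zpow (div_pos hK hu) (one_lt_two (α := ℝ))
  refine ⟨m + 1, (div_le_iff₀ hu).1 h2, ?_⟩
  rw [lt_div_iff₀ hu] at h1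
  rw [zpow_add_one₀ two_ne_zero]
  linarith

lemma level_eq (hK : 0 < K) (hu : 0 < infDist u S) (h1 : K ≤ (2 : ℝ) ^ j * infDist u S)
    (h2 : (2 : ℝ) ^ j * infDist u S < 2 * K) : level K S u = j := by
  obtain ⟨h3, h4⟩ := level_spec hK hu
  have key : ∀ i k : ℤ, K ≤ (2 : ℝ) ^ i * infDist u S → (2 : ℝ) ^ k * infDist u S < 2 * K →
      k ≤ i := by
    intro i k hi hk
    by_contra hc
    have h5 : (2 : ℝ) ^ (i + 1) ≤ 2 ^ k := zpow_le_zpow_right₀ one_le_two (by omega)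
    rw [zpow_add_one₀ two_ne_zero] at h5
    nlinarith
  exact le_antisymm (key _ _ h1 h4) (key _ _ h3 h2)

lemma abs_scaled_infDist_sub_le (S : Set (Vec n)) (j : ℤ) (x y : Vec n) :
    |(2 : ℝ) ^ j * infDist (((2 : ℝ) ^ j)⁻¹ • x) S -
      (2 : ℝ) ^ j * infDist (((2 : ℝ) ^ j)⁻¹ • y) S| ≤ ‖x - y‖ := by
  have hs : (0 : ℝ) < 2 ^ j := by positivity
  have h1 : |infDist (((2 : ℝ) ^ j)⁻¹ • x) S - infDist (((2 : ℝ) ^ j)⁻¹ • y) S| ≤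
      ((2 : ℝ) ^ j)⁻¹ * ‖x - y‖ := by
    have := (lipschitz_infDist_pt S).dist_le_mul (((2 : ℝ) ^ j)⁻¹ • x) (((2 : ℝ) ^ j)⁻¹ • y)
    rwa [NNReal.coe_one, one_mul, Real.dist_eq, dist_eq_norm, ← smul_sub, norm_smul,
      Real.norm_of_nonneg (by positivity)] at this
  rw [← mul_sub, abs_mul, abs_of_pos hs]
  calc _ ≤ (2 : ℝ) ^ j * (((2 : ℝ) ^ j)⁻¹ * ‖x - y‖) := mul_le_mul_of_nonneg_left h1 hs.le
    _ = ‖x - y‖ := by field_simp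

lemma norm_sub_latticeVec_le {κ : Fin n → ℤ} {v : Vec n} (h : node κ v ≠ 0) :
    ‖latticeVec κ - v‖ ≤ 1 := by
  rw [pi_norm_le_iff_of_nonneg zero_le_one]
  intro i
  obtain ⟨h1, h2⟩ := abs_sub_lt_of_node_ne_zero h i
  simp only [Pi.sub_apply, latticeVec, Real.norm_eq_abs, abs_le]
  constructor <;> linarith

lemma weight_eq_one (hK : 40 ≤ K) {y : Vec n} (hy : (2 : ℝ) ^ j * infDist y S ≤ 11 / 10 * K)
    {κ : Fin n → ℤ} (h : node κ ((2 : ℝ) ^ j • y) ≠ 0) : (whitneyData K S f).weight j κ = 1 := by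
  have hs : (2 : ℝ) ^ j ≠ 0 := by positivity
  have h1 := (abs_le.1 ((abs_scaled_infDist_sub_le S j (latticeVec κ) ((2 : ℝ) ^ j • y)).trans
    (norm_sub_latticeVec_le h))).2
  rw [inv_smul_smul₀ hs] at h1
  have h2 : (2 : ℝ) ^ j * infDist (((2 : ℝ) ^ j)⁻¹ • latticeVec κ) S / K ≤ 5 / 4 := by
    rw [div_le_iff₀ (by linarith)]; linarith
  simp only [whitneyData]
  rw [min_eq_left (by linarith), max_eq_right zero_le_one]

lemma weight_eq_zero (hK : 40 ≤ K) {y : Vec n} (hy : 19 / 10 * K ≤ (2 : ℝ) ^ j * infDist y S)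
    {κ : Fin n → ℤ} (h : node κ ((2 : ℝ) ^ j • y) ≠ 0) : (whitneyData K S f).weight j κ = 0 := by
  have hs : (2 : ℝ) ^ j ≠ 0 := by positivity
  have h1 := (abs_le.1 ((abs_scaled_infDist_sub_le S j (latticeVec κ) ((2 : ℝ) ^ j • y)).trans
    (norm_sub_latticeVec_le h))).1
  rw [inv_smul_smul₀ hs] at h1
  have h2 : 7 / 4 ≤ (2 : ℝ) ^ j * infDist (((2 : ℝ) ^ j)⁻¹ • latticeVec κ) S / K := by
    rw [le_div_iff₀ (by linarith)]; linarith
  simp only [whitneyData]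
  rw [max_eq_left]
  exact (min_le_right _ _).trans (by linarith)

lemma abs_weight_sub_le (hK : 0 < K) (κ κ' : Fin n → ℤ) :
    |(whitneyData K S f).weight j κ - (whitneyData K S f).weight j κ'| ≤
      2 / K * ‖latticeVec κ - latticeVec κ'‖ := by
  simp only [whitneyData]
  simp only [max_comm (0 : ℝ)]
  refine (abs_max_sub_max_le_abs _ _ _).trans ?_
  refine (abs_min_sub_min_le_max (1 : ℝ) _ 1 _).trans ?_
  rw [sub_self, abs_zero, max_eq_right (abs_nonneg _)]
  have h1 := abs_scaled_infDist_sub_le S j (latticeVec κ') (latticeVec κ)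
  rw [norm_sub_rev] at h1
  set a := (2 : ℝ) ^ j * infDist (((2 : ℝ) ^ j)⁻¹ • latticeVec κ) S
  set b := (2 : ℝ) ^ j * infDist (((2 : ℝ) ^ j)⁻¹ • latticeVec κ') S
  have e : 2 * (7 / 4 - a / K) - 2 * (7 / 4 - b / K) = 2 / K * (b - a) := by
    field_simp; ring
  rw [e, abs_mul, abs_of_pos (by positivity)]
  exact mul_le_mul_of_nonneg_left h1 (by positivity)

lemma weight_mem (κ : Fin n → ℤ) : |(whitneyData K S f).weight j κ| ≤ 1 := by
  simp only [whitneyData]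
  rw [abs_of_nonneg (le_max_left _ _)]
  exact max_le zero_le_one (min_le_left _ _)

lemma abs_off_le (e : Fin n → Fin 5) (i : Fin n) :
    (-1 : ℝ) ≤ (off e i : ℝ) ∧ (off e i : ℝ) ≤ 3 := by
  have h : -1 ≤ off e i ∧ off e i ≤ 3 := by
    simp only [off]
    have := (e i).isLt
    omega
  exact ⟨by exact_mod_cast h.1, by exact_mod_cast h.2⟩

lemma extension_eventuallyEq (hS : IsClosed S) (hne : S.Nonempty) (hK : 40 ≤ K) (hu : u ∉ S) :
    extension A K S f =ᶠ[𝓝 u] (whitneyData K S f).levelJet A (level K S u) := by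
  have hK0 : 0 < K := by linarith
  have hpos : 0 < infDist u S := (hS.notMem_iff_infDist_pos hne).1 hu
  obtain ⟨h1, h2⟩ := level_spec hK0 hpos
  set j := level K S u with hj
  have hc : ContinuousAt (fun y => (2 : ℝ) ^ j * infDist y S) u :=
    (continuous_const.mul (continuous_infDist_pt S)).continuousAt
  have hev : ∀ᶠ y in 𝓝 u, 19 / 20 * K < (2 : ℝ) ^ j * infDist y S ∧
      (2 : ℝ) ^ j * infDist y S < 2 * K :=
    hc.eventually (Ioo_mem_nhds (by linarith) h2)
  filter_upwards [hev] with y hy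
  have hy0 : 0 < infDist y S := by
    have : 0 < (2 : ℝ) ^ j * infDist y S := by linarith [hy.1]
    exact pos_of_mul_pos_right this (by positivity)
  have hyS : y ∉ S := (hS.notMem_iff_infDist_pos hne).2 hy0
  rw [extension, if_neg hyS]
  rcases le_or_gt K ((2 : ℝ) ^ j * infDist y S) with h | h
  · rw [level_eq hK0 hy0 h hy.2]
  · have hl : level K S y = j + 1 := by
      apply level_eq hK0 hy0 <;> rw [zpow_add_one₀ two_ne_zero] <;> linarith [hy.1]
    rw [hl]
    apply GridData.levelJet_succ_eq
    have hc' : ContinuousAt (fun y => (2 : ℝ) ^ j * infDist y S) y :=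
      (continuous_const.mul (continuous_infDist_pt S)).continuousAt
    have hev' : ∀ᶠ x in 𝓝 y, 19 / 20 * K < (2 : ℝ) ^ j * infDist x S ∧
        (2 : ℝ) ^ j * infDist x S < 11 / 10 * K :=
      hc'.eventually (Ioo_mem_nhds hy.1 (by linarith))
    filter_upwards [hev'] with x hx
    refine ⟨fun κ hκ => weight_eq_one hK hx.2.le hκ, fun κ hκ => weight_eq_zero hK ?_ hκ⟩
    rw [zpow_add_one₀ two_ne_zero]
    linarith [hx.1]

lemma scaled_dist_nearest_le (hS : IsClosed S) (hne : S.Nonempty) {a x : Vec n}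
    (ha : (2 : ℝ) ^ j * ‖u - a‖ ≤ 2 * K) (haS : a ∈ S) (hx : (2 : ℝ) ^ j * ‖u - x‖ ≤ 3) :
    (2 : ℝ) ^ j * ‖nearest S x - a‖ ≤ 4 * K + 6 := by
  have hs : (0 : ℝ) < 2 ^ j := by positivity
  have h1 : infDist x S ≤ ‖x - u‖ + ‖u - a‖ := by
    refine (infDist_le_dist_of_mem haS).trans ?_
    rw [dist_eq_norm]
    exact norm_sub_le_norm_sub_add_norm_sub _ _ _
  have h2 : ‖nearest S x - a‖ ≤ ‖nearest S x - x‖ + (‖x - u‖ + ‖u - a‖) :=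
    (norm_sub_le_norm_sub_add_norm_sub _ x _).trans
      (add_le_add_right (norm_sub_le_norm_sub_add_norm_sub _ _ _) _)
  have h3 : ‖nearest S x - x‖ = infDist x S := by
    rw [(nearest_spec hS hne x).2, dist_eq_norm, norm_sub_rev]
  rw [norm_sub_rev x u] at h1 h2
  have h4 : ‖nearest S x - a‖ ≤ 2 * (‖u - x‖ + ‖u - a‖) := by linarith
  have h5 := mul_le_mul_of_nonneg_left h4 hs.le
  linarith

lemma rescaled_bounds {s B : ℝ} {q q' : Jet n} (hs : 0 < s) {r : ℝ} (hr : s * r ≤ B)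
    (h : Near r q q') (h' : Near r q' q) :
    ‖s • (q.1 - q'.1)‖ ≤ B ∧ ‖s • (q.2.1 - q'.2.1)‖ ≤ B ∧
      |s ^ 2 * (q.2.2 - q'.2.2 - q.2.1 (q.1 - q'.1))| ≤ B ^ 2 := by
  have hr0 := h.nonneg
  refine ⟨?_, ?_, ?_⟩
  · rw [norm_smul, Real.norm_of_nonneg hs.le]
    exact (mul_le_mul_of_nonneg_left h.base hs.le).trans hr
  · rw [norm_smul, Real.norm_of_nonneg hs.le]
    exact (mul_le_mul_of_nonneg_left h.momentum hs.le).trans hr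
  · have e : q.2.2 - q'.2.2 - q.2.1 (q.1 - q'.1) = -(q'.2.2 - q.2.2 - q.2.1 (q'.1 - q.1)) := by
      simp only [map_sub]; ring
    rw [abs_mul, abs_of_nonneg (by positivity), e, abs_neg]
    calc _ ≤ s ^ 2 * r ^ 2 := mul_le_mul_of_nonneg_left h'.value (by positivity)
      _ = (s * r) ^ 2 := by ring
      _ ≤ B ^ 2 := by gcongr

lemma norm_normalize_le (hS : IsClosed S) (hne : S.Nonempty)
    (hf : ∀ a ∈ S, ∀ b ∈ S, Near ‖a - b‖ (f a) (f b)) {a v : Vec n} {κ : Fin n → ℤ} (haS : a ∈ S)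
    (ha : (2 : ℝ) ^ j * ‖u - a‖ ≤ 2 * K) (hu : (2 : ℝ) ^ j • u = v + latticeVec κ)
    (h : v ∈ Set.Icc (0 : Vec n) 1) :
    ‖(whitneyData K S f).normalize j κ (f a)‖ ≤ 1 + (4 * K + 6) + (4 * K + 6) ^ 2 := by
  have hs : (0 : ℝ) < 2 ^ j := by positivity
  have hB : 0 ≤ 4 * K + 6 := by
    have : 0 ≤ (2 : ℝ) ^ j * ‖u - a‖ := by positivity
    linarith
  set B := 4 * K + 6 with hBdef
  have hB2 : 0 ≤ B ^ 2 := by positivity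
  have hv : ∀ i, 0 ≤ v i ∧ v i ≤ 1 := fun i => ⟨h.1 i, h.2 i⟩
  have hdist : ∀ x : Vec n, (2 : ℝ) ^ j * ‖u - x‖ = ‖(2 : ℝ) ^ j • u - (2 : ℝ) ^ j • x‖ := by
    intro x
    rw [← smul_sub, norm_smul, Real.norm_of_nonneg hs.le]
  have hx₁ : ∀ e, (2 : ℝ) ^ j * ‖u - ((2 : ℝ) ^ j)⁻¹ • latticeVec (κ + off e)‖ ≤ 3 := by
    intro e
    rw [hdist, smul_inv_smul₀ hs.ne', hu, pi_norm_le_iff_of_nonneg (by norm_num)]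
    intro i
    have h1 := hv i
    have h2 := abs_off_le e i
    simp only [latticeVec, Pi.sub_apply, Pi.add_apply, Real.norm_eq_abs, Int.cast_add, abs_le]
    constructor <;> linarith
  have hx₂ : ∀ e, (2 : ℝ) ^ j * ‖u - ((2 : ℝ) ^ (j + 1))⁻¹ • latticeVec (κ + κ + off e)‖ ≤ 3 := by
    intro e
    have h0 : (2 : ℝ) ^ j • ((2 : ℝ) ^ (j + 1))⁻¹ • latticeVec (κ + κ + off e) =
        (1 / 2 : ℝ) • latticeVec (κ + κ + off e) := by
      rw [smul_smul, zpow_add_one₀ two_ne_zero]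
      congr 1
      field_simp
    rw [hdist, h0, hu, pi_norm_le_iff_of_nonneg (by norm_num)]
    intro i
    have h1 := hv i
    have h2 := abs_off_le e i
    simp only [latticeVec, Pi.sub_apply, Pi.add_apply, Pi.smul_apply, smul_eq_mul,
      Real.norm_eq_abs, Int.cast_add, abs_le]
    constructor <;> linarith
  have key : ∀ x : Vec n, (2 : ℝ) ^ j * ‖u - x‖ ≤ 3 →
      ‖(2 : ℝ) ^ j • ((f (nearest S x)).1 - (f a).1)‖ ≤ B ∧
      ‖(2 : ℝ) ^ j • ((f (nearest S x)).2.1 - (f a).2.1)‖ ≤ B ∧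
      |((2 : ℝ) ^ j) ^ 2 * ((f (nearest S x)).2.2 - (f a).2.2 -
        (f (nearest S x)).2.1 ((f (nearest S x)).1 - (f a).1))| ≤ B ^ 2 := by
    intro x hx
    have hn := (nearest_spec hS hne x).1
    have h' := hf a haS _ hn
    rw [norm_sub_rev] at h'
    exact rescaled_bounds hs (scaled_dist_nearest_le hS hne ha haS hx) (hf _ hn a haS) h'
  have hB0 : 0 ≤ 1 + B + B ^ 2 := by linarith
  simp only [GridData.normalize, norm_prod_le_iff]
  have hle : B ≤ 1 + B + B ^ 2 := by linarith
  refine ⟨(pi_norm_le_iff_of_nonneg hB0).2 fun e => ?_,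
    ⟨(pi_norm_le_iff_of_nonneg hB0).2 fun e => ?_, (pi_norm_le_iff_of_nonneg hB0).2 fun e => ?_⟩,
    ⟨(pi_norm_le_iff_of_nonneg hB0).2 fun e => ?_, (pi_norm_le_iff_of_nonneg hB0).2 fun e => ?_⟩,
    (pi_norm_le_iff_of_nonneg hB0).2 fun e => ?_, (pi_norm_le_iff_of_nonneg hB0).2 fun e => ?_⟩
  · exact (weight_mem _).trans (by linarith)
  · exact (key _ (hx₁ e)).1.trans hle
  · exact (key _ (hx₂ e)).1.trans hle
  · exact (key _ (hx₁ e)).2.1.trans hle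
  · exact (key _ (hx₂ e)).2.1.trans hle
  · exact (key _ (hx₁ e)).2.2.trans (by linarith)
  · exact (key _ (hx₂ e)).2.2.trans (by linarith)

end Extension

/-- Jets with controlled first-order behaviour on a ball are compatible. -/
lemma near_of_isContactAt {M r : ℝ} {F : Vec n → Jet n} {u u' : Vec n} (hM : 0 ≤ M)
    (hu : u ∈ closedBall u' r) (h : ∀ y ∈ closedBall u' r, IsContactAt M F y) :
    Near (M * r) (F u) (F u') := by
  have hr : 0 ≤ r := dist_nonneg.trans hu
  have hu' : u' ∈ closedBall u' r := mem_closedBall_self hr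
  have hur : ‖u - u'‖ ≤ r := by rwa [← dist_eq_norm]
  choose! D D' h1 h2 h3 h4 h5 using h
  have hP : ∀ y ∈ closedBall u' r, ‖(F y).2.1 - (F u').2.1‖ ≤ M * r := fun y hy =>
    ((convex_closedBall u' r).norm_image_sub_le_of_norm_hasFDerivWithin_le
      (fun x hx => (h4 x hx).hasFDerivWithinAt) h2 hu' hy).trans
      (mul_le_mul_of_nonneg_left (by rwa [← dist_eq_norm]) hM)
  refine ⟨?_, hP u hu, ?_⟩
  · exact ((convex_closedBall u' r).norm_image_sub_le_of_norm_hasFDerivWithin_le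
      (fun x hx => (h3 x hx).hasFDerivWithinAt) h1 hu' hu).trans
      (mul_le_mul_of_nonneg_left hur hM)
  · have hd : ∀ y ∈ closedBall u' r, HasFDerivWithinAt
        (fun y => (F y).2.2 - (F u').2.1 (F y).1) (((F y).2.1 - (F u').2.1) ∘L D y)
        (closedBall u' r) y := fun y hy =>
      ((h5 y hy).sub ((F u').2.1.hasFDerivAt.comp y (h3 y hy))).hasFDerivWithinAt
    have hb : ∀ y ∈ closedBall u' r, ‖((F y).2.1 - (F u').2.1) ∘L D y‖ ≤ M * r * M := fun y hy =>
      (ContinuousLinearMap.opNorm_comp_le _ _).trans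
        (mul_le_mul (hP y hy) (h1 y hy) (norm_nonneg _) (by positivity))
    have := (convex_closedBall u' r).norm_image_sub_le_of_norm_hasFDerivWithin_le hd hb hu' hu
    calc |(F u).2.2 - (F u').2.2 - (F u').2.1 ((F u).1 - (F u').1)|
        = ‖(F u).2.2 - (F u').2.1 (F u).1 - ((F u').2.2 - (F u').2.1 (F u').1)‖ := by
          rw [Real.norm_eq_abs, map_sub]; congr 1; ring
      _ ≤ M * r * M * r := this.trans (mul_le_mul_of_nonneg_left hur (by positivity))
      _ = (M * r) ^ 2 := by ring

/-- Compatible families of jets on closed sets extend, with control off the set. -/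
lemma exists_local_extension (n : ℕ) : ∃ M : ℝ, 0 ≤ M ∧ ∀ S : Set (Vec n), IsClosed S →
    S.Nonempty → ∀ f : Vec n → Jet n, (∀ a ∈ S, ∀ b ∈ S, Near ‖a - b‖ (f a) (f b)) →
    ∃ F : Vec n → Jet n, (∀ a ∈ S, F a = f a) ∧ ∀ u ∉ S, IsContactAt M F u ∧
      ∃ a ∈ S, ‖u - a‖ = infDist u S ∧ Near ((M + 1) * infDist u S) (F u) (f a) := by
  obtain ⟨ε, hε, hbd⟩ := exists_unitBounds n
  set K : ℝ := max 40 (8 / ε) with hKdef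
  have hK : 40 ≤ K := le_max_left _ _
  have hK0 : 0 < K := by linarith
  have hKε : 8 / K ≤ ε := by
    rw [div_le_iff₀ hK0, ← div_le_iff₀' hε]; exact le_max_right _ _
  obtain ⟨A, M, -, hM, hb⟩ := hbd (1 + (4 * K + 6) + (4 * K + 6) ^ 2)
  refine ⟨M, hM, fun S hS hne f hf => ⟨extension A K S f, fun a ha => if_pos ha, fun u hu => ?_⟩⟩
  have hpos : 0 < infDist u S := (hS.notMem_iff_infDist_pos hne).1 hu
  obtain ⟨h1, h2⟩ := level_spec hK0 hpos
  have heq := extension_eventuallyEq (A := A) (f := f) hS hne hK hu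
  set j := level K S u
  have hs : (0 : ℝ) < 2 ^ j := by positivity
  obtain ⟨κ, v, hv, huv⟩ := exists_eq_add_latticeVec ((2 : ℝ) ^ j • u)
  obtain ⟨haS, had⟩ := nearest_spec hS hne u
  set a := nearest S u
  rw [dist_eq_norm] at had
  have hub := hb ((whitneyData K S f).normalize j κ (f a))
    (norm_normalize_le hS hne hf haS (by rw [← had]; exact h2.le) huv hv) (fun e e' => by
      refine (abs_weight_sub_le (f := f) hK0 _ _).trans (le_trans ?_ hKε)
      have : ‖latticeVec (κ + off e) - latticeVec (κ + off e')‖ ≤ 4 := by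
        rw [pi_norm_le_iff_of_nonneg (by norm_num)]
        intro i
        have h1 := abs_off_le e i
        have h2 := abs_off_le e' i
        simp only [latticeVec, Pi.sub_apply, Pi.add_apply, Real.norm_eq_abs, Int.cast_add, abs_le]
        constructor <;> linarith
      calc _ ≤ 2 / K * 4 := mul_le_mul_of_nonneg_left this (by positivity)
        _ = 8 / K := by ring) v hv
  refine ⟨(GridData.levelJet_isContactAt huv hv hub).congr heq, a, haS, had.symm, ?_⟩
  rw [heq.self_of_nhds]
  refine (GridData.near_levelJet huv hv hM hub).mono ?_
  rw [mul_comm]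
  refine mul_le_mul_of_nonneg_left ?_ (by linarith)
  rw [inv_le_iff_one_le_mul₀ hs]
  linarith

/-- Compatible families of jets on closed sets extend to all of `ℝⁿ`. -/
theorem exists_extension (n : ℕ) : ∃ C : ℝ, 0 ≤ C ∧ ∀ S : Set (Vec n), IsClosed S →
    S.Nonempty → ∀ f : Vec n → Jet n, (∀ a ∈ S, ∀ b ∈ S, Near ‖a - b‖ (f a) (f b)) →
    ∃ F : Vec n → Jet n, (∀ a ∈ S, F a = f a) ∧ ∀ u u', Near (C * ‖u - u'‖) (F u) (F u') := by
  obtain ⟨M, hM, hext⟩ := exists_local_extension n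
  refine ⟨4 * M + 8, by linarith, fun S hS hne f hf => ?_⟩
  obtain ⟨F, hFS, hF⟩ := hext S hS hne f hf
  refine ⟨F, hFS, fun u u' => ?_⟩
  have hpt : ∀ x, ∃ a ∈ S, ‖x - a‖ = infDist x S ∧ Near ((M + 1) * infDist x S) (F x) (f a) := by
    intro x
    by_cases hx : x ∈ S
    · refine ⟨x, hx, by rw [sub_self, norm_zero, infDist_zero_of_mem hx], ?_⟩
      rw [hFS x hx, infDist_zero_of_mem hx, mul_zero]
      exact Near.refl
    · exact (hF x hx).2
  set r := ‖u - u'‖ with hr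
  have hr0 : 0 ≤ r := norm_nonneg _
  rcases lt_or_ge r (infDist u' S) with h | h
  · refine (near_of_isContactAt (r := r) hM (by rw [mem_closedBall, dist_eq_norm])
      fun y hy => (hF y fun hyS => ?_).1).mono (by nlinarith)
    have := infDist_le_dist_of_mem (x := u') hyS
    rw [mem_closedBall, dist_comm] at hy
    linarith
  · obtain ⟨a, ha, h1, h2⟩ := hpt u
    obtain ⟨a', ha', h1', h2'⟩ := hpt u'
    have h3 : infDist u S ≤ 2 * r := by
      have := infDist_le_infDist_add_dist (s := S) (x := u) (y := u')
      rw [dist_eq_norm] at this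
      linarith
    have h4 : ‖a - a'‖ ≤ 4 * r := by
      have e : a - a' = -(u - a) + (u - u') + (u' - a') := by abel
      rw [e]
      refine (norm_add₃_le ..).trans ?_
      rw [norm_neg]
      linarith
    refine ((h2.trans (hf a ha a' ha')).trans h2'.symm).mono ?_
    have h5 := mul_le_mul_of_nonneg_left h3 (by linarith : 0 ≤ M + 1)
    have h6 := mul_le_mul_of_nonneg_left h (by linarith : 0 ≤ M + 1)
    linarith

/-! ### The Heisenberg group as a space of jets -/

/-- The point of `ℍⁿ` with given coordinates. -/
def ofCoords (x y : Vec n) (t : ℝ) : Euc (2 * n + 1) :=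
  WithLp.toLp 2 fun i => if h : (i : ℕ) < 2 * n then
    (if (i : ℕ) % 2 = 0 then x ⟨(i : ℕ) / 2, by omega⟩ else y ⟨(i : ℕ) / 2, by omega⟩) else t

@[simp] lemma ofCoords_xIdx (x y : Vec n) (t : ℝ) (j : Fin n) :
    ofCoords x y t (xIdx n j) = x j := by
  have h : 2 * (j : ℕ) < 2 * n := by omega
  simp [ofCoords, xIdx, h]

@[simp] lemma ofCoords_yIdx (x y : Vec n) (t : ℝ) (j : Fin n) :
    ofCoords x y t (yIdx n j) = y j := by
  have h : 2 * (j : ℕ) + 1 < 2 * n := by omega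
  have h' : (2 * (j : ℕ) + 1) / 2 = j := by omega
  simp [ofCoords, yIdx, h, h']

@[simp] lemma ofCoords_tIdx (x y : Vec n) (t : ℝ) : ofCoords x y t (tIdx n) = t := by
  simp [ofCoords, tIdx]

lemma forall_idx {P : Fin (2 * n + 1) → Prop} (hx : ∀ j, P (xIdx n j)) (hy : ∀ j, P (yIdx n j))
    (ht : P (tIdx n)) (i : Fin (2 * n + 1)) : P i := by
  by_cases h : (i : ℕ) < 2 * n
  · rcases Nat.mod_two_eq_zero_or_one i with h2 | h2
    · have e : i = xIdx n ⟨(i : ℕ) / 2, by omega⟩ := by ext; simp only [xIdx]; omega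
      rw [e]; exact hx _
    · have e : i = yIdx n ⟨(i : ℕ) / 2, by omega⟩ := by ext; simp only [yIdx]; omega
      rw [e]; exact hy _
  · have e : i = tIdx n := by ext; simp only [tIdx]; omega
    rw [e]; exact ht

/-- The covector with given coordinates. -/
def covec (w : Vec n) : CoVec n :=
  ∑ j, w j • (ContinuousLinearMap.proj j : CoVec n)

lemma covec_apply (w v : Vec n) : covec w v = ∑ j, w j * v j := by
  simp [covec, _root_.sum_apply]

lemma covec_sub (w w' : Vec n) : covec w - covec w' = covec fun j => w j - w' j := by
  refine ContinuousLinearMap.ext fun v => ?_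
  rw [_root_.sub_apply]
  simp only [covec_apply, ← Finset.sum_sub_distrib, sub_mul]

lemma norm_covec_le {w : Vec n} {r : ℝ} (hr : 0 ≤ r) (h : ∀ j, |w j| ≤ r) :
    ‖covec w‖ ≤ n * r := by
  refine ContinuousLinearMap.opNorm_le_bound _ (by positivity) fun v => ?_
  rw [covec_apply, Real.norm_eq_abs]
  calc _ ≤ ∑ j, |w j * v j| := Finset.abs_sum_le_sum_abs _ _
    _ ≤ ∑ _j : Fin n, r * ‖v‖ := by
        refine Finset.sum_le_sum fun j _ => ?_
        rw [abs_mul]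
        exact mul_le_mul (h j) (norm_le_pi_norm v j) (abs_nonneg _) hr
    _ = n * r * ‖v‖ := by simp [mul_assoc]

lemma apply_single_le_norm (P : CoVec n) (j : Fin n) : |P (Pi.single j 1)| ≤ ‖P‖ := by
  have := P.le_opNorm (Pi.single j 1)
  rwa [Pi.norm_single, norm_one, mul_one] at this

@[simp] lemma covec_single (w : Vec n) (j : Fin n) : covec w (Pi.single j 1) = w j := by
  simp [covec_apply, Pi.single_apply]

/-- The jet coordinates of a point of `ℍⁿ`, in which horizontality reads `z' = p x'`. -/
def toJet (q : Euc (2 * n + 1)) : Jet n :=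
  (fun j => q (xIdx n j), covec fun j => q (yIdx n j),
    (q (tIdx n) + 2 * ∑ j, q (xIdx n j) * q (yIdx n j)) / 4)

/-- The point of `ℍⁿ` with given jet coordinates. -/
def ofJet (q : Jet n) : Euc (2 * n + 1) :=
  ofCoords q.1 (fun j => q.2.1 (Pi.single j 1))
    (4 * q.2.2 - 2 * ∑ j, q.1 j * q.2.1 (Pi.single j 1))

@[simp] lemma toJet_ofJet (q : Jet n) : toJet (ofJet q) = q := by
  obtain ⟨x, P, z⟩ := q
  refine Prod.ext ?_ (Prod.ext ?_ ?_)
  · simp [toJet, ofJet]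
  · refine ContinuousLinearMap.ext fun v => ?_
    simp only [toJet, ofJet, ofCoords_yIdx, covec_apply]
    conv_rhs => rw [pi_eq_sum_univ' v]
    simp [map_sum, mul_comm]
  · simp [toJet, ofJet]

/-- The defect of two points from being joined by a straight horizontal lift. -/
lemma toJet_value_eq (p q : Euc (2 * n + 1)) :
    4 * ((toJet q).2.2 - (toJet p).2.2 - (toJet p).2.1 ((toJet q).1 - (toJet p).1)) =
      q (tIdx n) - p (tIdx n) -
        2 * ∑ j, (p (yIdx n j) * (q (xIdx n j) - p (xIdx n j)) -
          p (xIdx n j) * (q (yIdx n j) - p (yIdx n j))) +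
      2 * ∑ j, (q (xIdx n j) - p (xIdx n j)) * (q (yIdx n j) - p (yIdx n j)) := by
  have key : 2 * ∑ j, q (xIdx n j) * q (yIdx n j) - 2 * ∑ j, p (xIdx n j) * p (yIdx n j) -
      4 * ∑ j, p (yIdx n j) * (q (xIdx n j) - p (xIdx n j)) =
      2 * ∑ j, (q (xIdx n j) - p (xIdx n j)) * (q (yIdx n j) - p (yIdx n j)) -
      2 * ∑ j, (p (yIdx n j) * (q (xIdx n j) - p (xIdx n j)) -
        p (xIdx n j) * (q (yIdx n j) - p (yIdx n j))) := by
    simp only [Finset.mul_sum, ← Finset.sum_sub_distrib]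
    exact Finset.sum_congr rfl fun j _ => by ring
  simp only [toJet, covec_apply, Pi.sub_apply]
  linear_combination key

section Curves

variable {a b : ℝ} {γ g : ℝ → Euc (2 * n + 1)}

/-- The speed of the projection of a curve. -/
def speed (w : Euc (2 * n + 1)) : ℝ :=
  Real.sqrt (∑ j : Fin n, ((w (xIdx n j)) ^ 2 + (w (yIdx n j)) ^ 2))

lemma speed_nonneg (w : Euc (2 * n + 1)) : 0 ≤ speed w := Real.sqrt_nonneg _

lemma abs_xIdx_le_speed (w : Euc (2 * n + 1)) (j : Fin n) : |w (xIdx n j)| ≤ speed w := by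
  refine Real.abs_le_sqrt ((le_add_of_nonneg_right (sq_nonneg (w (yIdx n j)))).trans ?_)
  exact Finset.single_le_sum (f := fun j => (w (xIdx n j)) ^ 2 + (w (yIdx n j)) ^ 2)
    (fun i _ => by positivity) (Finset.mem_univ j)

lemma abs_yIdx_le_speed (w : Euc (2 * n + 1)) (j : Fin n) : |w (yIdx n j)| ≤ speed w := by
  refine Real.abs_le_sqrt ((le_add_of_nonneg_left (sq_nonneg (w (xIdx n j)))).trans ?_)
  exact Finset.single_le_sum (f := fun j => (w (xIdx n j)) ^ 2 + (w (yIdx n j)) ^ 2)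
    (fun i _ => by positivity) (Finset.mem_univ j)

lemma speed_le {w : Euc (2 * n + 1)} {B : ℝ} (hB : 0 ≤ B) (hx : ∀ j, |w (xIdx n j)| ≤ B)
    (hy : ∀ j, |w (yIdx n j)| ≤ B) : speed w ≤ 2 * n * B := by
  rw [speed, Real.sqrt_le_left (by positivity)]
  calc _ ≤ ∑ _j : Fin n, (B ^ 2 + B ^ 2) :=
        Finset.sum_le_sum fun j _ => add_le_add (sq_le_sq' (abs_le.1 (hx j)).1 (abs_le.1 (hx j)).2)
          (sq_le_sq' (abs_le.1 (hy j)).1 (abs_le.1 (hy j)).2)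
    _ = 2 * n * B ^ 2 := by simp; ring
    _ ≤ (2 * n * B) ^ 2 := by
        have : (n : ℝ) ≤ (n : ℝ) ^ 2 := by exact_mod_cast Nat.le_self_pow two_ne_zero n
        nlinarith [sq_nonneg B]

lemma speed_le_sum (w : Euc (2 * n + 1)) :
    speed w ≤ ∑ j, (|w (xIdx n j)| + |w (yIdx n j)|) := by
  rw [speed, Real.sqrt_le_left (Finset.sum_nonneg fun j _ => by positivity)]
  refine le_trans (Finset.sum_le_sum fun j _ => ?_)
    (Finset.sum_sq_le_sq_sum_of_nonneg fun j _ => by positivity)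
  rw [← sq_abs (w (xIdx n j)), ← sq_abs (w (yIdx n j))]
  nlinarith [abs_nonneg (w (xIdx n j)), abs_nonneg (w (yIdx n j))]

lemma horizLength_eq (a b : ℝ) (g : ℝ → Euc (2 * n + 1)) :
    horizLength n a b g = ∫ s in a..b, speed (g s) := rfl

lemma intervalIntegrable_speed (h : ∀ i, IntervalIntegrable (fun s => g s i) volume a b) :
    IntervalIntegrable (fun s => speed (g s)) volume a b := by
  have hs : IntervalIntegrable (fun s => ∑ j, (|g s (xIdx n j)| + |g s (yIdx n j)|))
      volume a b := by
    have := IntervalIntegrable.sum (μ := volume) (a := a) (b := b) Finset.univ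
      (f := fun j s => |g s (xIdx n j)| + |g s (yIdx n j)|)
      fun j _ => (h (xIdx n j)).abs.add (h (yIdx n j)).abs
    simpa [Finset.sum_fn] using this
  refine hs.mono_fun ?_ ?_
  · have hm : ∀ i, AEMeasurable (fun s => g s i) (volume.restrict (uIoc a b)) := fun i =>
      (h i).def'.aestronglyMeasurable.aemeasurable
    refine AEMeasurable.aestronglyMeasurable ?_
    refine Real.continuous_sqrt.measurable.comp_aemeasurable ?_
    exact Finset.aemeasurable_fun_sum _ fun j _ =>
      ((hm (xIdx n j)).pow_const 2).add ((hm (yIdx n j)).pow_const 2)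
  · refine Eventually.of_forall fun s => ?_
    simp only [Real.norm_eq_abs]
    rw [abs_of_nonneg (speed_nonneg _)]
    exact (speed_le_sum _).trans (le_abs_self _)

lemma horizLength_nonneg (hab : a ≤ b) : 0 ≤ horizLength n a b g :=
  intervalIntegral.integral_nonneg hab fun _ _ => speed_nonneg _

lemma bddBelow_lengths (p q : Euc (2 * n + 1)) :
    BddBelow {ℓ : ℝ | ∃ a b γ g, a ≤ b ∧ IsHorizontalWith n a b γ g ∧
      γ a = p ∧ γ b = q ∧ ℓ = horizLength n a b g} := by
  refine ⟨0, ?_⟩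
  rintro _ ⟨a, b, γ, g, hab, -, -, -, rfl⟩
  exact horizLength_nonneg hab

/-- Coordinates vary by at most the length. -/
lemma abs_coord_sub_le (hab : a ≤ b) (h : IsHorizontalWith n a b γ g) {i : Fin (2 * n + 1)}
    (hi : ∀ w : Euc (2 * n + 1), |w i| ≤ speed w) {x : ℝ} (hx : x ∈ Set.Icc a b) :
    |γ x i - γ a i| ≤ horizLength n a b g := by
  have hsp := intervalIntegrable_speed h.1
  rw [h.2.1 i x hx, add_sub_cancel_left, horizLength_eq]
  calc _ ≤ ∫ s in a..x, speed (g s) := by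
        rw [← Real.norm_eq_abs]
        refine intervalIntegral.norm_integral_le_of_norm_le hx.1
          (Eventually.of_forall fun s _ => hi (g s))
          (hsp.mono_set (by rw [uIcc_of_le hx.1, uIcc_of_le hab]; exact Icc_subset_Icc_right hx.2))
    _ ≤ ∫ s in a..b, speed (g s) :=
        intervalIntegral.integral_mono_interval le_rfl hx.1 hx.2
          (Eventually.of_forall fun s => speed_nonneg _) hsp

/-- A horizontal curve moves the jet coordinates by at most a multiple of its length. -/
lemma near_of_isHorizontalWith (hn : 1 ≤ n) (hab : a ≤ b) (h : IsHorizontalWith n a b γ g) :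
    Near (2 * n * horizLength n a b g) (toJet (γ b)) (toJet (γ a)) := by
  set ℓ := horizLength n a b g with hℓ
  have hℓ0 : 0 ≤ ℓ := horizLength_nonneg hab
  have hn' : (1 : ℝ) ≤ n := by exact_mod_cast hn
  have hb : b ∈ Set.Icc a b := right_mem_Icc.2 hab
  have hx : ∀ j, ∀ s ∈ Set.Icc a b, |γ s (xIdx n j) - γ a (xIdx n j)| ≤ ℓ := fun j s hs =>
    abs_coord_sub_le hab h (fun w => abs_xIdx_le_speed w j) hs
  have hy : ∀ j, ∀ s ∈ Set.Icc a b, |γ s (yIdx n j) - γ a (yIdx n j)| ≤ ℓ := fun j s hs =>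
    abs_coord_sub_le hab h (fun w => abs_yIdx_le_speed w j) hs
  have hprod : |2 * ∑ j, (γ b (xIdx n j) - γ a (xIdx n j)) * (γ b (yIdx n j) - γ a (yIdx n j))| ≤
      2 * n * ℓ ^ 2 := by
    rw [abs_mul, abs_two, mul_assoc]
    refine mul_le_mul_of_nonneg_left ((Finset.abs_sum_le_sum_abs _ _).trans ?_) zero_le_two
    calc _ ≤ ∑ _j : Fin n, ℓ ^ 2 := Finset.sum_le_sum fun j _ => by
          rw [abs_mul, sq]; exact mul_le_mul (hx j b hb) (hy j b hb) (abs_nonneg _) hℓ0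
      _ = n * ℓ ^ 2 := by simp
  have harea : |γ b (tIdx n) - γ a (tIdx n) -
        2 * ∑ j, (γ a (yIdx n j) * (γ b (xIdx n j) - γ a (xIdx n j)) -
          γ a (xIdx n j) * (γ b (yIdx n j) - γ a (yIdx n j)))| ≤ 4 * n * ℓ ^ 2 := by
    have hint : IntervalIntegrable (fun s => ∑ j, (γ a (yIdx n j) * g s (xIdx n j) -
        γ a (xIdx n j) * g s (yIdx n j))) volume a b := by
      have := IntervalIntegrable.sum (μ := volume) (a := a) (b := b) Finset.univ
        (f := fun j s => γ a (yIdx n j) * g s (xIdx n j) - γ a (xIdx n j) * g s (yIdx n j))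
        fun j _ => ((h.1 (xIdx n j)).const_mul _).sub ((h.1 (yIdx n j)).const_mul _)
      simpa [Finset.sum_fn] using this
    have e : γ b (tIdx n) - γ a (tIdx n) -
        2 * ∑ j, (γ a (yIdx n j) * (γ b (xIdx n j) - γ a (xIdx n j)) -
          γ a (xIdx n j) * (γ b (yIdx n j) - γ a (yIdx n j))) =
        ∫ s in a..b, (g s (tIdx n) - 2 * ∑ j, (γ a (yIdx n j) * g s (xIdx n j) -
          γ a (xIdx n j) * g s (yIdx n j))) := by
      rw [intervalIntegral.integral_sub (h.1 _) (hint.const_mul 2),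
        intervalIntegral.integral_const_mul, intervalIntegral.integral_finsetSum
          fun j _ => ((h.1 (xIdx n j)).const_mul _).sub ((h.1 (yIdx n j)).const_mul _)]
      simp only [h.2.1 _ b hb, add_sub_cancel_left]
      congr 2
      refine Finset.sum_congr rfl fun j _ => ?_
      rw [intervalIntegral.integral_sub ((h.1 (xIdx n j)).const_mul _)
        ((h.1 (yIdx n j)).const_mul _), intervalIntegral.integral_const_mul,
        intervalIntegral.integral_const_mul]
    rw [e, ← Real.norm_eq_abs]
    have hae : ∀ᵐ s ∂volume, s ∈ Set.Ioc a b →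
        ‖g s (tIdx n) - 2 * ∑ j, (γ a (yIdx n j) * g s (xIdx n j) -
          γ a (xIdx n j) * g s (yIdx n j))‖ ≤ 4 * n * ℓ * speed (g s) := by
      filter_upwards [(ae_restrict_iff' measurableSet_Icc).1 h.2.2] with s hs hs'
      have hsI := Ioc_subset_Icc_self hs'
      rw [hs hsI, ← mul_sub, ← Finset.sum_sub_distrib, Real.norm_eq_abs, abs_mul, abs_two]
      have hsp : 0 ≤ speed (g s) := speed_nonneg _
      calc _ ≤ 2 * ∑ _j : Fin n, (ℓ * speed (g s) + ℓ * speed (g s)) := by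
            refine mul_le_mul_of_nonneg_left ((Finset.abs_sum_le_sum_abs _ _).trans
              (Finset.sum_le_sum fun j _ => ?_)) zero_le_two
            have e' : γ s (yIdx n j) * g s (xIdx n j) - γ s (xIdx n j) * g s (yIdx n j) -
                (γ a (yIdx n j) * g s (xIdx n j) - γ a (xIdx n j) * g s (yIdx n j)) =
                (γ s (yIdx n j) - γ a (yIdx n j)) * g s (xIdx n j) -
                  (γ s (xIdx n j) - γ a (xIdx n j)) * g s (yIdx n j) := by ring
            rw [e']
            refine (abs_sub _ _).trans ?_
            rw [abs_mul, abs_mul]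
            exact add_le_add
              (mul_le_mul (hy j s hsI) (abs_xIdx_le_speed _ j) (abs_nonneg _) hℓ0)
              (mul_le_mul (hx j s hsI) (abs_yIdx_le_speed _ j) (abs_nonneg _) hℓ0)
        _ = 4 * n * ℓ * speed (g s) := by simp; ring
    refine (intervalIntegral.norm_integral_le_of_norm_le hab hae
      ((intervalIntegrable_speed h.1).const_mul _)).trans ?_
    rw [intervalIntegral.integral_const_mul, ← horizLength_eq, ← hℓ]
    exact le_of_eq (by ring)
  refine ⟨?_, ?_, ?_⟩
  · rw [pi_norm_le_iff_of_nonneg (by positivity)]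
    intro j
    exact (hx j b hb).trans (by nlinarith)
  · have e : (toJet (γ b)).2.1 - (toJet (γ a)).2.1 =
        covec fun j => γ b (yIdx n j) - γ a (yIdx n j) := covec_sub _ _
    rw [e]
    exact (norm_covec_le hℓ0 fun j => hy j b hb).trans (by nlinarith [mul_nonneg n.cast_nonneg hℓ0])
  · have h1 := (abs_add_le _ _).trans (add_le_add harea hprod)
    rw [← toJet_value_eq, abs_mul, abs_of_pos (by norm_num : (0 : ℝ) < 4)] at h1
    have h2 : (n : ℝ) * ℓ ^ 2 ≤ n ^ 2 * ℓ ^ 2 := by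
      refine mul_le_mul_of_nonneg_right ?_ (sq_nonneg _)
      nlinarith
    nlinarith [mul_nonneg (n.cast_nonneg : (0:ℝ) ≤ n) (sq_nonneg ℓ)]

/-- Smooth curves satisfying the contact condition are horizontal. -/
lemma isHorizontalWith_of_hasDerivAt {X Y X' Y' : ℝ → Vec n} {T T' : ℝ → ℝ}
    (hX : ∀ j s, HasDerivAt (fun s => X s j) (X' s j) s)
    (hY : ∀ j s, HasDerivAt (fun s => Y s j) (Y' s j) s)
    (hT : ∀ s, HasDerivAt T (T' s) s)
    (hX' : ∀ j, Continuous fun s => X' s j) (hY' : ∀ j, Continuous fun s => Y' s j)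
    (h : ∀ s, T' s = 2 * ∑ j, (Y s j * X' s j - X s j * Y' s j)) (a b : ℝ) :
    IsHorizontalWith n a b (fun s => ofCoords (X s) (Y s) (T s))
      (fun s => ofCoords (X' s) (Y' s) (T' s)) := by
  have hT' : Continuous T' := by
    have hXc : ∀ j, Continuous fun s => X s j := fun j =>
      continuous_iff_continuousAt.2 fun s => (hX j s).continuousAt
    have hYc : ∀ j, Continuous fun s => Y s j := fun j =>
      continuous_iff_continuousAt.2 fun s => (hY j s).continuousAt
    rw [show T' = fun s => 2 * ∑ j, (Y s j * X' s j - X s j * Y' s j) from funext h]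
    exact continuous_const.mul (continuous_finsetSum _ fun j _ =>
      ((hYc j).mul (hX' j)).sub ((hXc j).mul (hY' j)))
  have ftc : ∀ {φ φ' : ℝ → ℝ}, (∀ s, HasDerivAt φ (φ' s) s) → Continuous φ' → ∀ x,
      φ x = φ a + ∫ s in a..x, φ' s := fun hφ hc x => by
    rw [intervalIntegral.integral_eq_sub_of_hasDerivAt (fun s _ => hφ s)
      (hc.intervalIntegrable _ _)]
    ring
  refine ⟨forall_idx ?_ ?_ ?_, forall_idx ?_ ?_ ?_, Eventually.of_forall fun s => ?_⟩
  · intro j; simpa using (hX' j).intervalIntegrable a b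
  · intro j; simpa using (hY' j).intervalIntegrable a b
  · simpa using hT'.intervalIntegrable a b
  · intro j x _; simpa using ftc (hX j) (hX' j) x
  · intro j x _; simpa using ftc (hY j) (hY' j) x
  · intro x _; simpa using ftc hT hT' x
  · simpa using h s

lemma ofCoords_eq_iff {x y : Vec n} {t : ℝ} {q : Euc (2 * n + 1)} :
    ofCoords x y t = q ↔ (∀ j, x j = q (xIdx n j)) ∧ (∀ j, y j = q (yIdx n j)) ∧
      t = q (tIdx n) := by
  constructor
  · rintro rfl; simp
  · rintro ⟨h1, h2, h3⟩
    ext i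
    exact forall_idx (P := fun i => ofCoords x y t i = q i) (by simpa using h1) (by simpa using h2)
      (by simpa using h3) i

/-- Nearby jets are joined by a short horizontal curve: a segment in the projection, corrected
by cubic polynomials to adjust the enclosed area. -/
lemma exists_horizontal_of_near (hn : 1 ≤ n) {p q : Euc (2 * n + 1)} {r : ℝ}
    (h : Near r (toJet q) (toJet p)) : ∃ γ g : ℝ → Euc (2 * n + 1),
      IsHorizontalWith n 0 1 γ g ∧ γ 0 = p ∧ γ 1 = q ∧ horizLength n 0 1 g ≤ 200 * n ^ 2 * r := by
  have hr := h.nonneg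
  have hn' : (1 : ℝ) ≤ n := by exact_mod_cast hn
  set D : Vec n := fun j => q (xIdx n j) - p (xIdx n j) with hD
  set R : Vec n := fun j => q (yIdx n j) - p (yIdx n j) with hR
  set τ : ℝ := q (tIdx n) - p (tIdx n) -
    2 * ∑ j, (p (yIdx n j) * D j - p (xIdx n j) * R j) with hτ
  have hDr : ∀ j, |D j| ≤ r := fun j =>
      (norm_le_pi_norm (f := (toJet q).1 - (toJet p).1) j).trans h.base
  have hRr : ∀ j, |R j| ≤ r := fun j => by
    have := (apply_single_le_norm ((toJet q).2.1 - (toJet p).2.1) j).trans h.momentum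
    rwa [_root_.sub_apply, toJet, toJet, covec_single, covec_single] at this
  have hτr : |τ| ≤ (4 + 2 * n) * r ^ 2 := by
    have e := toJet_value_eq p q
    have h1 : |∑ j, D j * R j| ≤ n * r ^ 2 := by
      refine (Finset.abs_sum_le_sum_abs _ _).trans ?_
      calc _ ≤ ∑ _j : Fin n, r ^ 2 := Finset.sum_le_sum fun j _ => by
            rw [abs_mul, sq]; exact mul_le_mul (hDr j) (hRr j) (abs_nonneg _) hr
        _ = n * r ^ 2 := by simp
    have h2 := abs_le.1 h.value
    have h3 := abs_le.1 h1
    rw [abs_le]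
    constructor <;> linarith [h2.1, h2.2, h3.1, h3.2]
  have hτdiv : r * (τ / r) = τ := by
    rcases hr.eq_or_lt with h0 | h0
    · rw [← h0] at hτr ⊢
      have : τ = 0 := by simpa using hτr
      simp [this]
    · field_simp
  have hτdiv' : |τ / r| ≤ (4 + 2 * n) * r := by
    rcases hr.eq_or_lt with h0 | h0
    · rw [← h0]; simp
    · rw [abs_div, abs_of_pos h0, div_le_iff₀ h0]; linarith
  set b : Vec n := fun j => 15 / 2 * (τ / r / n + 2 / 3 * R j) with hb
  have hbr : ∀ j, |b j| ≤ 60 * n * r := fun j => by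
    have h1 : |τ / r / n| ≤ (4 + 2 * n) * r := by
      rw [abs_div, Nat.abs_cast]
      exact (div_le_self (abs_nonneg _) hn').trans hτdiv'
    have h2 := abs_le.1 h1
    have h3 := abs_le.1 (hRr j)
    have h4 : r ≤ n * r := by nlinarith
    simp only [hb]
    rw [abs_le]
    constructor <;> linarith [h2.1, h2.2, h3.1, h3.2]
  let X : ℝ → Vec n := fun s j => p (xIdx n j) + D j * s + r * (s - s ^ 2)
  let Y : ℝ → Vec n := fun s j => p (yIdx n j) + R j * s + b j * (s - 3 * s ^ 2 + 2 * s ^ 3)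
  let X' : ℝ → Vec n := fun s j => D j + r * (1 - 2 * s)
  let Y' : ℝ → Vec n := fun s j => R j + b j * (1 - 6 * s + 6 * s ^ 2)
  let V : Fin n → ℝ → ℝ := fun j s =>
    (p (yIdx n j) * (D j + r) - p (xIdx n j) * (R j + b j)) * s +
    (3 * b j * p (xIdx n j) - r * p (yIdx n j)) * s ^ 2 +
    (b j * (D j + r) - r * (R j + b j) / 3 - 2 * b j * p (xIdx n j)) * s ^ 3 -
    b j * (D j + r) * s ^ 4 + 2 / 5 * r * b j * s ^ 5
  have hpow : ∀ (m : ℕ) (s : ℝ), HasDerivAt (fun s : ℝ => s ^ m) (m * s ^ (m - 1)) s :=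
    fun m s => hasDerivAt_pow m s
  have hX : ∀ j s, HasDerivAt (fun s => X s j) (X' s j) s := fun j s => by
    refine ((((hasDerivAt_id s).const_mul (D j)).const_add (p (xIdx n j))).add
      (((hasDerivAt_id s).sub (hpow 2 s)).const_mul r)).congr_deriv ?_
    simp [X']
  have hY : ∀ j s, HasDerivAt (fun s => Y s j) (Y' s j) s := fun j s => by
    refine ((((hasDerivAt_id s).const_mul (R j)).const_add (p (yIdx n j))).add
      ((((hasDerivAt_id s).sub ((hpow 2 s).const_mul 3)).add
        ((hpow 3 s).const_mul 2)).const_mul (b j))).congr_deriv ?_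
    simp only [Y', Nat.cast_ofNat, Nat.reduceSub]; ring
  have hV : ∀ j s, HasDerivAt (V j) (Y s j * X' s j - X s j * Y' s j) s := fun j s => by
    refine ((((((hasDerivAt_id s).const_mul _).add ((hpow 2 s).const_mul _)).add
      ((hpow 3 s).const_mul _)).sub ((hpow 4 s).const_mul _)).add
        ((hpow 5 s).const_mul _)).congr_deriv ?_
    simp only [X, Y, X', Y', Nat.cast_ofNat, Nat.reduceSub]; ring
  let T : ℝ → ℝ := fun s => p (tIdx n) + 2 * ∑ j, V j s
  have hT : ∀ s, HasDerivAt T (2 * ∑ j, (Y s j * X' s j - X s j * Y' s j)) s := fun s =>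
    ((HasDerivAt.fun_sum fun j _ => hV j s).const_mul 2).const_add _
  refine ⟨_, _, isHorizontalWith_of_hasDerivAt hX hY hT (fun j => by fun_prop)
    (fun j => by fun_prop) (fun s => rfl) 0 1, ?_, ?_, ?_⟩
  · rw [ofCoords_eq_iff]
    simp [X, Y, T, V]
  · rw [ofCoords_eq_iff]
    refine ⟨fun j => ?_, fun j => ?_, ?_⟩
    · simp [X, D]
    · simp only [Y, R]; ring
    · have e : ∀ j, V j 1 = (p (yIdx n j) * D j - p (xIdx n j) * R j) + τ / 2 / n := fun j => by
        have e1 : τ / 2 / n = r * (τ / r) / 2 / n := by rw [hτdiv]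
        rw [e1]
        simp only [V, hb]
        ring
      simp only [T, e, Finset.sum_add_distrib, Finset.sum_const, Finset.card_univ, Fintype.card_fin,
        nsmul_eq_mul]
      have : (n : ℝ) * (τ / 2 / n) = τ / 2 := by field_simp
      rw [this]
      linarith
  · rw [horizLength_eq]
    have hle : ∀ s ∈ Set.Icc (0 : ℝ) 1,
        speed (ofCoords (X' s) (Y' s) (2 * ∑ j, (Y s j * X' s j - X s j * Y' s j))) ≤
          2 * n * (100 * n * r) := by
      intro s hs
      have hnr : r ≤ n * r := by nlinarith
      refine speed_le (by positivity) (fun j => ?_) fun j => ?_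
      · rw [ofCoords_xIdx]
        have h1 : |r * (1 - 2 * s)| ≤ r * 1 := by
          rw [abs_mul, abs_of_nonneg hr]
          refine mul_le_mul_of_nonneg_left ?_ hr
          rw [abs_le]; constructor <;> linarith [hs.1, hs.2]
        exact (abs_add_le _ _).trans (by linarith [hDr j])
      · rw [ofCoords_yIdx]
        have h1 : |b j * (1 - 6 * s + 6 * s ^ 2)| ≤ 60 * n * r * 1 := by
          rw [abs_mul]
          refine mul_le_mul (hbr j) ?_ (abs_nonneg _) (by positivity)
          rw [abs_le]; constructor <;> nlinarith [hs.1, hs.2, sq_nonneg (s - 1 / 2)]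
        exact (abs_add_le _ _).trans (by linarith [hRr j])
    calc _ ≤ ‖∫ s in (0 : ℝ)..1,
          speed (ofCoords (X' s) (Y' s) (2 * ∑ j, (Y s j * X' s j - X s j * Y' s j)))‖ :=
          Real.le_norm_self _
      _ ≤ 2 * n * (100 * n * r) * |1 - 0| := by
          refine intervalIntegral.norm_integral_le_of_norm_le_const fun s hs => ?_
          rw [uIoc_of_le zero_le_one] at hs
          rw [Real.norm_of_nonneg (speed_nonneg _)]
          exact hle s (Ioc_subset_Icc_self hs)
      _ = 200 * n ^ 2 * r := by simp; ring

end Curves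

lemma ccDist_le_of_near (hn : 1 ≤ n) {p q : Euc (2 * n + 1)} {r : ℝ}
    (h : Near r (toJet q) (toJet p)) : ccDist n p q ≤ 200 * n ^ 2 * r := by
  obtain ⟨γ, g, h1, h2, h3, h4⟩ := exists_horizontal_of_near hn h
  exact (csInf_le (bddBelow_lengths p q) ⟨0, 1, γ, g, zero_le_one, h1, h2, h3, rfl⟩).trans h4

lemma exists_near (q q' : Jet n) : ∃ r, Near r q q' := by
  set a := ‖q.1 - q'.1‖
  set b := ‖q.2.1 - q'.2.1‖
  set c := |q.2.2 - q'.2.2 - q'.2.1 (q.1 - q'.1)|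
  have ha : 0 ≤ a := norm_nonneg _
  have hb : 0 ≤ b := norm_nonneg _
  have hc : 0 ≤ c := abs_nonneg _
  exact ⟨a + b + c + 1, by linarith, by linarith, by nlinarith⟩

lemma near_of_ccDist_le (hn : 1 ≤ n) {p q : Euc (2 * n + 1)} {r : ℝ} (h : ccDist n p q ≤ r) :
    Near (2 * n * r) (toJet q) (toJet p) := by
  have hne : {ℓ : ℝ | ∃ a b γ g, a ≤ b ∧ IsHorizontalWith n a b γ g ∧
      γ a = p ∧ γ b = q ∧ ℓ = horizLength n a b g}.Nonempty := by
    obtain ⟨s, hs⟩ := exists_near (toJet q) (toJet p)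
    obtain ⟨γ, g, h1, h2, h3, -⟩ := exists_horizontal_of_near hn hs
    exact ⟨_, 0, 1, γ, g, zero_le_one, h1, h2, h3, rfl⟩
  have key : ∀ ε ∈ Set.Ioi (0 : ℝ), Near (2 * n * (r + ε)) (toJet q) (toJet p) := by
    intro ε hε
    obtain ⟨_, ⟨a, b, γ, g, hab, hh, rfl, rfl, rfl⟩, hlt⟩ :=
      exists_lt_of_csInf_lt hne (h.trans_lt (lt_add_of_pos_right r hε))
    exact (near_of_isHorizontalWith hn hab hh).mono
      (mul_le_mul_of_nonneg_left hlt.le (by positivity))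
  have hlim : Tendsto (fun ε : ℝ => 2 * n * (r + ε)) (𝓝[>] 0) (𝓝 (2 * n * r)) := by
    have : Continuous fun ε : ℝ => 2 * n * (r + ε) := by fun_prop
    simpa using (this.tendsto 0).mono_left nhdsWithin_le_nhds
  have hev : ∀ᶠ ε in 𝓝[>] (0 : ℝ), Near (2 * n * (r + ε)) (toJet q) (toJet p) :=
    eventually_mem_nhdsWithin.mono key
  exact ⟨ge_of_tendsto hlim (hev.mono fun _ h => h.base),
    ge_of_tendsto hlim (hev.mono fun _ h => h.momentum),
    ge_of_tendsto (hlim.pow 2) (hev.mono fun _ h => h.value)⟩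

/-! ### Extension of maps from spheres -/

/-- The Heisenberg dilation in jet coordinates. -/
def dilate (s : ℝ) (q : Jet n) : Jet n := (s • q.1, s • q.2.1, s ^ 2 * q.2.2)

lemma dilate_dilate_inv {s : ℝ} (hs : s ≠ 0) (q : Jet n) : dilate s (dilate s⁻¹ q) = q := by
  simp only [dilate, smul_inv_smul₀ hs]
  rw [← mul_assoc, ← mul_pow, mul_inv_cancel₀ hs, one_pow, one_mul]

lemma Near.dilate {q q' : Jet n} {r s : ℝ} (h : Near r q q') (hs : 0 ≤ s) :
    Near (s * r) (dilate s q) (dilate s q') := by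
  refine ⟨?_, ?_, ?_⟩
  · simp only [HeisenbergExtension.dilate, ← smul_sub, norm_smul, Real.norm_of_nonneg hs]
    exact mul_le_mul_of_nonneg_left h.base hs
  · have e : s • q.2.1 - s • q'.2.1 = s • (q.2.1 - q'.2.1) := (smul_sub _ _ _).symm
    simp only [HeisenbergExtension.dilate]
    rw [e, norm_smul, Real.norm_of_nonneg hs]
    exact mul_le_mul_of_nonneg_left h.momentum hs
  · have e : s ^ 2 * q.2.2 - s ^ 2 * q'.2.2 - (s • q'.2.1) (s • q.1 - s • q'.1) =
        s ^ 2 * (q.2.2 - q'.2.2 - q'.2.1 (q.1 - q'.1)) := by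
      rw [← smul_sub, map_smul, _root_.smul_apply, smul_eq_mul, smul_eq_mul]
      ring
    simp only [HeisenbergExtension.dilate]
    rw [e, abs_mul, abs_of_nonneg (sq_nonneg s), mul_pow]
    exact mul_le_mul_of_nonneg_left h.value (sq_nonneg s)

/-- Padding with zeros. -/
def pad (m n : ℕ) (x : Euc m) : Vec n := fun i => if h : (i : ℕ) < m then x ⟨i, h⟩ else 0

lemma pad_sub {m : ℕ} (x y : Euc m) : pad m n (x - y) = pad m n x - pad m n y := by
  ext i
  simp only [pad, Pi.sub_apply]
  split_ifs <;> simp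

lemma norm_pad_le {m : ℕ} (x : Euc m) : ‖pad m n x‖ ≤ ‖x‖ := by
  rw [pi_norm_le_iff_of_nonneg (norm_nonneg _)]
  intro i
  simp only [pad]
  split_ifs
  · exact PiLp.norm_apply_le x _
  · simp

lemma pad_castLE {m : ℕ} (hm : m ≤ n) (x : Euc m) (i : Fin m) :
    pad m n x (Fin.castLE hm i) = x i := by
  simp [pad]

lemma norm_le_norm_pad {m : ℕ} (hm : m ≤ n) (x : Euc m) : ‖x‖ ≤ n * ‖pad m n x‖ := by
  rw [EuclideanSpace.norm_eq, Real.sqrt_le_left (by positivity)]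
  calc _ ≤ ∑ _i : Fin m, ‖pad m n x‖ ^ 2 := Finset.sum_le_sum fun i _ => by
        have := norm_le_pi_norm (pad m n x) (Fin.castLE hm i)
        rw [pad_castLE] at this
        gcongr
    _ = m * ‖pad m n x‖ ^ 2 := by simp
    _ ≤ n ^ 2 * ‖pad m n x‖ ^ 2 := by
        refine mul_le_mul_of_nonneg_right ?_ (sq_nonneg _)
        exact_mod_cast hm.trans (Nat.le_self_pow two_ne_zero n)
    _ = (n * ‖pad m n x‖) ^ 2 := by ring

lemma isCompact_pad_sphere (m n : ℕ) : IsCompact (pad m n '' sphere 0 1) := by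
  refine (isCompact_sphere 0 1).image (LipschitzWith.continuous (K := 1) ?_)
  refine LipschitzWith.of_dist_le_mul fun x y => ?_
  rw [dist_eq_norm, dist_eq_norm, ← pad_sub, NNReal.coe_one, one_mul]
  exact norm_pad_le _

/-- Maps from spheres extend to balls when the Lipschitz constant is positive. -/
lemma exists_sphere_extension (hn : 1 ≤ n) : ∃ C : ℝ, 0 ≤ C ∧ ∀ m, 1 ≤ m → m ≤ n → ∀ L : ℝ, 0 < L →
    ∀ f : Euc m → Euc (2 * n + 1), (∀ x ∈ sphere (0 : Euc m) 1, ∀ y ∈ sphere (0 : Euc m) 1,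
      ccDist n (f x) (f y) ≤ L * dist x y) →
    ∃ F : Euc m → Euc (2 * n + 1), (∀ x y, ccDist n (F x) (F y) ≤ C * L * dist x y) ∧
      ∀ x ∈ sphere (0 : Euc m) 1, F x = f x := by
  classical
  obtain ⟨C, hC, hext⟩ := exists_extension n
  refine ⟨200 * n ^ 2 * (2 * n ^ 2) * C, by positivity, fun m hm1 hm L hL f hf => ?_⟩
  have hn' : (0 : ℝ) < n := by exact_mod_cast hn
  set s : ℝ := 2 * n ^ 2 * L with hs
  have hs0 : 0 < s := by positivity
  obtain ⟨G, hG, hGnear⟩ := hext (pad m n '' sphere 0 1) (isCompact_pad_sphere m n).isClosed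
    (Set.Nonempty.image _ ⟨EuclideanSpace.single ⟨0, hm1⟩ 1, by simp⟩)
    (fun a => dilate s⁻¹ (toJet (f (WithLp.toLp 2 fun i => a (Fin.castLE hm i))))) (by
      have hinv : ∀ x : Euc m, WithLp.toLp 2 (fun i => pad m n x (Fin.castLE hm i)) = x :=
        fun x => by ext i; simp [pad_castLE]
      rintro _ ⟨x, hx, rfl⟩ _ ⟨y, hy, rfl⟩
      simp only [hinv]
      refine ((near_of_ccDist_le hn (hf y hy x hx)).dilate (inv_nonneg.2 hs0.le)).mono ?_
      rw [inv_mul_le_iff₀ hs0, dist_comm, dist_eq_norm, ← pad_sub]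
      calc 2 * n * (L * ‖x - y‖) ≤ 2 * n * (L * (n * ‖pad m n (x - y)‖)) := by
            gcongr; exact norm_le_norm_pad hm _
        _ = s * ‖pad m n (x - y)‖ := by rw [hs]; ring)
  let F : Euc m → Euc (2 * n + 1) := fun x =>
    if x ∈ sphere (0 : Euc m) 1 then f x else ofJet (dilate s (G (pad m n x)))
  have hF : ∀ x, toJet (F x) = dilate s (G (pad m n x)) := fun x => by
    by_cases hx : x ∈ sphere (0 : Euc m) 1
    · have e : WithLp.toLp 2 (fun i => pad m n x (Fin.castLE hm i)) = x := by
        ext i; simp [pad_castLE]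
      rw [hG _ (mem_image_of_mem _ hx), e, dilate_dilate_inv hs0.ne']
      simp only [F, if_pos hx]
    · simp only [F, if_neg hx, toJet_ofJet]
  refine ⟨F, fun x y => ?_, fun x hx => if_pos hx⟩
  have h := (hGnear (pad m n y) (pad m n x)).dilate hs0.le
  rw [← hF, ← hF, ← pad_sub] at h
  refine (ccDist_le_of_near hn h).trans ?_
  calc 200 * (n : ℝ) ^ 2 * (s * (C * ‖pad m n (y - x)‖)) ≤ 200 * n ^ 2 * (s * (C * ‖y - x‖)) := by
        gcongr; exact norm_pad_le _
    _ = 200 * n ^ 2 * (2 * n ^ 2) * C * L * dist x y := by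
        rw [dist_comm, dist_eq_norm, hs]; ring

end HeisenbergExtension

/-- **Theorem (Wenger–Young): `ℍⁿ` is Lipschitz `(n−1)`-connected.**
There is `γ ≥ 1` such that for every `0 ≤ k ≤ n−1` and `L ≥ 0`, every `L`-Lipschitz map
`f : S^k → ℍⁿ` (w.r.t. the Carnot–Carathéodory metric) has a `γL`-Lipschitz extension
`F : B^{k+1} → ℍⁿ`. -/
theorem heisenberg_lipschitz_connected (n : ℕ) (hn : 1 ≤ n) :
    ∃ c : ℝ, 1 ≤ c ∧
      ∀ k : ℕ, k < n → ∀ L : ℝ, 0 ≤ L →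
        ∀ f : Euc (k+1) → Euc (2*n+1),
          (∀ x ∈ Metric.sphere (0 : Euc (k+1)) 1, ∀ y ∈ Metric.sphere (0 : Euc (k+1)) 1,
            ccDist n (f x) (f y) ≤ L * dist x y) →
          ∃ F : Euc (k+1) → Euc (2*n+1),
            (∀ x ∈ Metric.closedBall (0 : Euc (k+1)) 1,
              ∀ y ∈ Metric.closedBall (0 : Euc (k+1)) 1,
                ccDist n (F x) (F y) ≤ c * L * dist x y) ∧
            ∀ x ∈ Metric.sphere (0 : Euc (k+1)) 1, F x = f x := by
  classical
  obtain ⟨C, hC, hext⟩ := HeisenbergExtension.exists_sphere_extension hn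
  refine ⟨max 1 C, le_max_left _ _, fun k hk L hL f hf => ?_⟩
  rcases hL.eq_or_lt with rfl | hL
  · have hx₀ : EuclideanSpace.single (0 : Fin (k + 1)) (1 : ℝ) ∈ sphere (0 : Euc (k + 1)) 1 := by
      simp
    set ρ : Euc (k + 1) → Euc (k + 1) := fun x =>
      if x ∈ sphere (0 : Euc (k + 1)) 1 then x else EuclideanSpace.single 0 1 with hρ
    have hmem : ∀ x, ρ x ∈ sphere (0 : Euc (k + 1)) 1 := fun x => by
      simp only [hρ]
      split_ifs with h
      exacts [h, hx₀]
    refine ⟨fun x => f (ρ x), fun x _ y _ => ?_, fun x hx => by simp only [hρ, if_pos hx]⟩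
    simpa using hf _ (hmem x) _ (hmem y)
  · obtain ⟨F, h1, h2⟩ := hext (k + 1) (by omega) (by omega) L hL f hf
    refine ⟨F, fun x _ y _ => (h1 x y).trans ?_, h2⟩
    gcongr
    exact le_max_right _ _

end
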